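/- Let Δ be the tetrahedral group [3,5,3]⁺, let p be a prime with p ≡ ±1 (mod 5) and p ≡ 1, 3, 4, 5 or 9 (mod 11), and let s ∈ F_p satisfy s² = 5. If 3+2s and 3−2s are both squares in F_p, then Δ has exactly four normal subgroups K with Δ/K isomorphic to PSL(2, F_p) and none with Δ/K isomorphic to PSL(2, F_{p²}); if 3+2s and 3−2s are both non-squares in F_p, then Δ has exactly two normal subgroups K with Δ/K isomorphic to PSL(2, F_{p²}) and none with Δ/K isomorphic to PSL(2, F_p). -/

import Mathlib

/-- The relators of the tetrahedral group `Δ = [3,5,3]⁺`, on generators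
`α = of 0`, `β = of 1`, `γ = of 2`. -/
def tetRelators : Set (FreeGroup (Fin 3)) :=
  { FreeGroup.of 0 ^ 3, FreeGroup.of 1 ^ 5, FreeGroup.of 2 ^ 3,
    (FreeGroup.of 0 * FreeGroup.of 1) ^ 2, (FreeGroup.of 1 * FreeGroup.of 2) ^ 2,
    (FreeGroup.of 0 * FreeGroup.of 1 * FreeGroup.of 2) ^ 2 }

/-- The tetrahedral group `Δ = [3,5,3]⁺` as a presented group. -/
abbrev Tet : Type := PresentedGroup tetRelators

/-- `K` is a normal subgroup of `Δ` with `Δ/K ≅ PSL(2, F)`. -/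
def IsPSLQuotient (F : Type) [Field F] (K : Subgroup Tet) : Prop :=
  ∃ f : Tet →* Matrix.ProjectiveSpecialLinearGroup (Fin 2) F,
    Function.Surjective f ∧ f.ker = K

namespace TetPSL

open Matrix
open scoped MatrixGroups

section Algebra

variable {k R : Type*} [CommRing k] [Ring R] [Algebra k R]

/-- The linear combination `c₀ + c₁ a + c₂ b + c₃ ab`. -/
def comb (a b : R) (c : Fin 4 → k) : R :=
  c 0 • 1 + c 1 • a + c 2 • b + c 3 • (a * b)

/-- The multiplication rules satisfied by two matrices of determinant `1` whose traces are `1`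
and `t` and whose product has trace `0`. -/
structure Rules (t : k) (a b : R) : Prop where
  aa : a * a = a - 1
  bb : b * b = t • b - 1
  ba : b * a = t • a + b - a * b - t • 1

variable {t : k} {a b : R}

lemma Rules.comb_mul_left (h : Rules t a b) (c : Fin 4 → k) :
    comb a b c * a =
      comb a b ![-c 1 - t * c 2 - t * c 3, c 0 + c 1 + t * c 2, c 2 + c 3, -c 2] := by
  have aba : a * b * a = b - t • 1 := by
    rw [mul_assoc, h.ba]
    simp only [mul_sub, mul_add, ← mul_assoc, mul_smul_comm, h.aa, mul_one, sub_mul, one_mul,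
      smul_sub]
    abel
  simp only [comb, add_mul, smul_mul_assoc, aba, h.aa, h.ba, one_mul]
  simp only [cons_val]
  module

lemma Rules.comb_mul_right (h : Rules t a b) (c : Fin 4 → k) :
    comb a b c * b = comb a b ![-c 2, -c 3, c 0 + t * c 2, c 1 + t * c 3] := by
  simp only [comb, add_mul, smul_mul_assoc, mul_assoc, h.bb, one_mul, mul_sub, mul_smul_comm,
    mul_one]
  simp only [cons_val]
  module

lemma comb_add (c d : Fin 4 → k) : comb a b c + comb a b d = comb a b (c + d) := by
  simp only [comb, Pi.add_apply]
  module

lemma comb_smul (r : k) (c : Fin 4 → k) : r • comb a b c = comb a b (r • c) := by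
  simp only [comb, Pi.smul_apply, smul_eq_mul]
  module

lemma comb_one : comb a b (![1, 0, 0, 0] : Fin 4 → k) = 1 := by simp [comb]

lemma comb_left : comb a b (![0, 1, 0, 0] : Fin 4 → k) = a := by simp [comb]

lemma comb_right : comb a b (![0, 0, 1, 0] : Fin 4 → k) = b := by simp [comb]

lemma Rules.mul_mem (h : Rules t a b) {y z : R} (hy : ∃ c : Fin 4 → k, y = comb a b c)
    (hz : ∃ c : Fin 4 → k, z = comb a b c) : ∃ c : Fin 4 → k, y * z = comb a b c := by
  obtain ⟨c, rfl⟩ := hy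
  obtain ⟨d, rfl⟩ := hz
  conv in _ * _ => rw [comb.eq_def a b d]
  simp only [mul_add, mul_smul_comm, mul_one, ← mul_assoc]
  rw [h.comb_mul_left c, h.comb_mul_right c, h.comb_mul_right, comb_smul, comb_smul, comb_smul,
    comb_smul, comb_add, comb_add, comb_add]
  exact ⟨_, rfl⟩

/-- A monoid homomorphism from the free group whose values on the generators and on their inverses
are combinations has only combinations as values. -/
lemma Rules.freeGroup_mem (h : Rules t a b) {ι : Type*} (φ : FreeGroup ι →* R)
    (hφ : ∀ i, (∃ c : Fin 4 → k, φ (FreeGroup.of i) = comb a b c) ∧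
      ∃ c : Fin 4 → k, φ (FreeGroup.of i)⁻¹ = comb a b c) (w : FreeGroup ι) :
    ∃ c : Fin 4 → k, φ w = comb a b c := by
  induction w using FreeGroup.induction_on with
  | C1 => exact ⟨_, (map_one φ).trans comb_one.symm⟩
  | of i => exact (hφ i).1
  | inv_of i _ => exact (hφ i).2
  | mul x y hx hy => rw [map_mul]; exact h.mul_mem hx hy

end Algebra

section Matrices

variable {F : Type*} [Field F]

/-- Two unimodular matrices with traces `1` and `t`, where `t² = t + 1`, whose product has
trace `0`. -/
structure TetPair (t : F) (A B : Matrix (Fin 2) (Fin 2) F) : Prop where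
  det_left : A.det = 1
  det_right : B.det = 1
  trace_left : A.trace = 1
  trace_right : B.trace = t
  trace_mul : (A * B).trace = 0
  sq : t ^ 2 = t + 1

lemma mul_self_eq (M : Matrix (Fin 2) (Fin 2) F) : M * M = M.trace • M - M.det • 1 := by
  ext i j
  fin_cases i <;> fin_cases j <;> simp [mul_apply, trace_fin_two, det_fin_two] <;> ring

lemma mul_comm_eq (M N : Matrix (Fin 2) (Fin 2) F) :
    N * M = N.trace • M + M.trace • N - M * N + ((M * N).trace - M.trace * N.trace) • 1 := by
  ext i j
  fin_cases i <;> fin_cases j <;> simp [mul_apply, trace_fin_two] <;> ring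

namespace TetPair

variable {t : F} {A B : Matrix (Fin 2) (Fin 2) F}

lemma rules (h : TetPair t A B) : Rules t A B where
  aa := by rw [mul_self_eq, h.trace_left, h.det_left, one_smul, one_smul]
  bb := by rw [mul_self_eq, h.trace_right, h.det_right, one_smul]
  ba := by
    rw [mul_comm_eq A B, h.trace_left, h.trace_right, h.trace_mul, one_smul, zero_sub, one_mul,
      neg_smul, ← sub_eq_add_neg]

lemma trace_comb (h : TetPair t A B) (c : Fin 4 → F) :
    (comb A B c).trace = 2 * c 0 + c 1 + t * c 2 := by
  simp only [comb, trace_add, trace_smul, h.trace_left, h.trace_right, h.trace_mul, trace_one]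
  simp
  ring

lemma trace_left_mul_comb (h : TetPair t A B) (c : Fin 4 → F) :
    (A * comb A B c).trace = c 0 - c 1 - t * c 3 := by
  rw [trace_mul_comm, h.rules.comb_mul_left, h.trace_comb]
  simp only [cons_val]
  ring

lemma trace_right_mul_comb (h : TetPair t A B) (c : Fin 4 → F) :
    (B * comb A B c).trace = t * c 0 + (t - 1) * c 2 - c 3 := by
  rw [trace_mul_comm, h.rules.comb_mul_right, h.trace_comb]
  simp only [cons_val]
  linear_combination c 2 * h.sq

lemma trace_mul_mul_comb (h : TetPair t A B) (c : Fin 4 → F) :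
    (A * B * comb A B c).trace = -t * c 1 - c 2 - 2 * c 3 := by
  rw [trace_mul_comm, ← mul_assoc, h.rules.comb_mul_left, h.rules.comb_mul_right, h.trace_comb]
  simp only [cons_val]
  ring

/-- The trace form is nondegenerate on the span of `1, A, B, AB`. -/
lemma coeff_eq_zero (h : TetPair t A B) {c : Fin 4 → F} (h₀ : (comb A B c).trace = 0)
    (h₁ : (A * comb A B c).trace = 0) (h₂ : (B * comb A B c).trace = 0)
    (h₃ : (A * B * comb A B c).trace = 0) : c = 0 := by
  rw [h.trace_comb] at h₀
  rw [h.trace_left_mul_comb] at h₁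
  rw [h.trace_right_mul_comb] at h₂
  rw [h.trace_mul_mul_comb] at h₃
  have ht := h.sq
  have e1 : c 1 = 0 := by grind
  have e3 : c 3 = 0 := by grind
  have e2 : c 2 = 0 := by grind
  have e0 : c 0 = 0 := by grind
  ext i
  fin_cases i <;> assumption

lemma comb_injective (h : TetPair t A B) : Function.Injective (comb (k := F) A B) := by
  intro c d hcd
  have : comb A B (c - d) = 0 := by
    rw [sub_eq_add_neg, ← comb_add, ← neg_one_smul F d, ← comb_smul, hcd]
    simp
  rw [← sub_eq_zero]
  apply h.coeff_eq_zero <;> simp [this]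

lemma exists_comb (h : TetPair t A B) (M : Matrix (Fin 2) (Fin 2) F) :
    ∃ c : Fin 4 → F, M = comb A B c := by
  let L : (Fin 4 → F) →ₗ[F] Matrix (Fin 2) (Fin 2) F :=
    { toFun := comb A B
      map_add' := fun c d => (comb_add c d).symm
      map_smul' := fun r c => (comb_smul r c).symm }
  have hL : Function.Injective L := h.comb_injective
  obtain ⟨c, hc⟩ := (LinearMap.injective_iff_surjective_of_finrank_eq_finrank
    (by simp [Module.finrank_matrix])).1 hL M
  exact ⟨c, hc.symm⟩

/-- Two unimodular matrices as in `TetPair` have no common eigenline. -/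
lemma nilpotent_eq_zero (h : TetPair t A B) (h2 : (2 : F) ≠ 0) (h3 : (3 : F) ≠ 0)
    {N : Matrix (Fin 2) (Fin 2) F} (hN : N * N = 0) (h₀ : N.trace = 0) (h₁ : (A * N).trace = 0)
    (h₂ : (B * N).trace = 0) : N = 0 := by
  obtain ⟨c, rfl⟩ := h.exists_comb N
  have h₄ : (comb A B c * comb A B c).trace = c 3 * (A * B * comb A B c).trace := by
    conv_lhs => enter [1, 1]; rw [comb]
    simp [add_mul, h₀, h₁, h₂]
  rw [hN, trace_zero, zero_eq_mul] at h₄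
  obtain h₃ | h₃ := h₄
  · rw [h.trace_comb] at h₀
    rw [h.trace_left_mul_comb] at h₁
    rw [h.trace_right_mul_comb] at h₂
    have ht := h.sq
    have e2 : c 2 = 0 := by
      have : 2 * c 2 = 0 := by grind
      simpa [h2] using this
    have e1 : c 1 = 0 := by
      have : 3 * c 1 = 0 := by grind
      simpa [h3] using this
    have e0 : c 0 = 0 := by grind
    simp [comb, e0, e1, e2, h₃]
  · rw [h.coeff_eq_zero h₀ h₁ h₂ h₃]
    simp [comb]

end TetPair

/-- The coordinates of the third matrix of a triple in terms of the first two. -/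
def thirdCoeff {k : Type*} [CommRing k] (t x : k) : Fin 4 → k :=
  ![(t + 1) * x - 2 * t - 1, (t + 1) * (1 - 2 * x), 2 * t + 1, (2 * t + 1) * (x - 1)]

/-- Three unimodular matrices whose traces are those of the images of `α, β, γ`. -/
structure TetTriple (t x : F) (A B C : Matrix (Fin 2) (Fin 2) F) : Prop extends
    TetPair t A B where
  det_third : C.det = 1
  trace_third : C.trace = 1
  trace_right_third : (B * C).trace = 0
  trace_left_third : (A * C).trace = x
  trace_mul_third : (A * B * C).trace = 0

namespace TetTriple

variable {t x : F} {A B C : Matrix (Fin 2) (Fin 2) F}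

lemma third_eq (h : TetTriple t x A B C) : C = comb A B (thirdCoeff t x) := by
  obtain ⟨c, rfl⟩ := h.exists_comb C
  congr 1
  rw [← sub_eq_zero]
  have h₀ := h.trace_third
  have h₁ := h.trace_left_third
  have h₂ := h.trace_right_third
  have h₃ := h.trace_mul_third
  rw [h.trace_comb] at h₀
  rw [h.trace_left_mul_comb] at h₁
  rw [h.trace_right_mul_comb] at h₂
  rw [h.trace_mul_mul_comb] at h₃
  have ht := h.sq
  apply h.coeff_eq_zero
  · rw [h.trace_comb]; simp [thirdCoeff]; grind
  · rw [h.trace_left_mul_comb]; simp [thirdCoeff]; grind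
  · rw [h.trace_right_mul_comb]; simp [thirdCoeff]; grind
  · rw [h.trace_mul_mul_comb]; simp [thirdCoeff]; grind

end TetTriple

lemma TetPair.det_third {t : F} {A B : Matrix (Fin 2) (Fin 2) F} (h : TetPair t A B)
    (h2 : (2 : F) ≠ 0) (x : F) :
    (comb A B (thirdCoeff t x)).det - 1 = (x ^ 2 - x + t - 1) * (t + 1) := by
  have e := congrArg trace (mul_self_eq (comb A B (thirdCoeff t x)))
  have e' : (comb A B (thirdCoeff t x) * comb A B (thirdCoeff t x)).trace =
      thirdCoeff t x 0 + thirdCoeff t x 1 * x := by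
    conv_lhs => enter [1, 1]; rw [comb]
    simp only [add_mul, smul_mul_assoc, one_mul, trace_add, trace_smul, h.trace_comb,
      h.trace_left_mul_comb, h.trace_right_mul_comb, h.trace_mul_mul_comb]
    simp [thirdCoeff]
    have := h.sq
    grind
  rw [e', trace_sub, trace_smul, trace_smul, h.trace_comb, trace_one] at e
  generalize (comb A B (thirdCoeff t x)).det = d at e ⊢
  simp [thirdCoeff] at e
  have := h.sq
  apply mul_left_cancel₀ h2
  grind

lemma TetPair.triple {t x : F} {A B : Matrix (Fin 2) (Fin 2) F} (h : TetPair t A B)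
    (h2 : (2 : F) ≠ 0) (hx : x ^ 2 - x + t - 1 = 0) :
    TetTriple t x A B (comb A B (thirdCoeff t x)) where
  toTetPair := h
  det_third := by
    have := h.det_third h2 x
    rwa [hx, zero_mul, sub_eq_zero] at this
  trace_third := by rw [h.trace_comb]; have := h.sq; simp [thirdCoeff]; grind
  trace_right_third := by rw [h.trace_right_mul_comb]; have := h.sq; simp [thirdCoeff]; grind
  trace_left_third := by rw [h.trace_left_mul_comb]; have := h.sq; simp [thirdCoeff]; grind
  trace_mul_third := by rw [h.trace_mul_mul_comb]; have := h.sq; simp [thirdCoeff]; grind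

lemma TetTriple.eq_zero {t x : F} {A B C : Matrix (Fin 2) (Fin 2) F} (h : TetTriple t x A B C)
    (h2 : (2 : F) ≠ 0) : x ^ 2 - x + t - 1 = 0 := by
  have e := h.toTetPair.det_third h2 x
  rw [← h.third_eq, h.det_third, sub_self, zero_eq_mul] at e
  refine e.resolve_right fun ht => ?_
  have := h.sq
  grind

end Matrices

section Lifts

variable {F : Type*} [Field F]

lemma mem_center_iff_exists_smul {g : SL(2, F)} :
    g ∈ Subgroup.center SL(2, F) ↔ ∃ s : F, (g : Matrix (Fin 2) (Fin 2) F) = s • 1 := by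
  rw [Matrix.SpecialLinearGroup.mem_center_iff]
  constructor
  · rintro ⟨s, -, hs⟩
    exact ⟨s, by rw [← hs, smul_one_eq_diagonal]; rfl⟩
  · rintro ⟨s, hs⟩
    refine ⟨s, ?_, by rw [hs, smul_one_eq_diagonal]; rfl⟩
    have := g.det_coe
    rw [hs] at this
    simpa using this

lemma mem_center_iff_eq {g : SL(2, F)} : g ∈ Subgroup.center SL(2, F) ↔ g = 1 ∨ g = -1 := by
  rw [mem_center_iff_exists_smul]
  constructor
  · rintro ⟨s, hs⟩
    have := g.det_coe
    rw [hs] at this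
    simp only [det_smul, Fintype.card_fin, det_one, mul_one, sq_eq_one_iff] at this
    obtain rfl | rfl := this
    · exact Or.inl (Subtype.ext (by simpa using hs))
    · exact Or.inr (Subtype.ext (by simpa using hs))
  · rintro (rfl | rfl)
    · exact ⟨1, by simp⟩
    · exact ⟨-1, by simp⟩

lemma mk_eq_mk_iff {g h : SL(2, F)} : (g : PSL(2, F)) = h ↔ g = h ∨ g = -h := by
  rw [eq_comm, QuotientGroup.eq, mem_center_iff_eq, inv_mul_eq_iff_eq_mul, inv_mul_eq_iff_eq_mul]
  simp

lemma mk_eq_one_iff {g : SL(2, F)} : (g : PSL(2, F)) = 1 ↔ g = 1 ∨ g = -1 :=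
  mk_eq_mk_iff (h := 1)

lemma mk_neg (g : SL(2, F)) : ((-g : SL(2, F)) : PSL(2, F)) = g := mk_eq_mk_iff.2 (Or.inr rfl)

lemma trace_neg_coe (g : SL(2, F)) :
    ((-g : SL(2, F)) : Matrix (Fin 2) (Fin 2) F).trace =
      -(g : Matrix (Fin 2) (Fin 2) F).trace := by
  simp

lemma coe_mul_self (g : SL(2, F)) : (g : Matrix (Fin 2) (Fin 2) F) * g =
    (g : Matrix (Fin 2) (Fin 2) F).trace • (g : Matrix (Fin 2) (Fin 2) F) - 1 := by
  rw [mul_self_eq, g.det_coe, one_smul]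

lemma mk_pow_eq_one_iff {g : SL(2, F)} {n : ℕ} :
    (g : PSL(2, F)) ^ n = 1 ↔ ∃ s : F, (g : Matrix (Fin 2) (Fin 2) F) ^ n = s • 1 := by
  rw [← QuotientGroup.mk_pow, QuotientGroup.eq_one_iff, mem_center_iff_exists_smul]
  simp only [Matrix.SpecialLinearGroup.coe_pow]

lemma mk_pow_eq_one_iff_of_pow_eq {g : SL(2, F)} (hg : (g : PSL(2, F)) ≠ 1) {n : ℕ} {r s : F}
    (h : (g : Matrix (Fin 2) (Fin 2) F) ^ n = r • (g : Matrix (Fin 2) (Fin 2) F) - s • 1) :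
    (g : PSL(2, F)) ^ n = 1 ↔ r = 0 := by
  rw [mk_pow_eq_one_iff]
  constructor
  · rintro ⟨s', hs'⟩
    by_contra hr
    apply hg
    rw [QuotientGroup.eq_one_iff, mem_center_iff_exists_smul]
    refine ⟨r⁻¹ * (s' + s), ?_⟩
    rw [mul_smul, add_smul, ← hs', h, sub_add_cancel, smul_smul, inv_mul_cancel₀ hr, one_smul]
  · rintro rfl
    exact ⟨-s, by simp [h]⟩

lemma mk_sq_eq_one_iff {g : SL(2, F)} (hg : (g : PSL(2, F)) ≠ 1) :
    (g : PSL(2, F)) ^ 2 = 1 ↔ (g : Matrix (Fin 2) (Fin 2) F).trace = 0 := by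
  refine mk_pow_eq_one_iff_of_pow_eq hg (s := 1) ?_
  rw [sq, coe_mul_self, one_smul]

lemma mk_pow_three_eq_one_iff {g : SL(2, F)} (hg : (g : PSL(2, F)) ≠ 1) :
    (g : PSL(2, F)) ^ 3 = 1 ↔ (g : Matrix (Fin 2) (Fin 2) F).trace ^ 2 - 1 = 0 := by
  refine mk_pow_eq_one_iff_of_pow_eq hg (s := (g : Matrix (Fin 2) (Fin 2) F).trace) ?_
  rw [pow_succ, sq, coe_mul_self, sub_mul, smul_mul_assoc, coe_mul_self, one_mul]
  module

lemma mk_pow_five_eq_one_iff {g : SL(2, F)} (hg : (g : PSL(2, F)) ≠ 1) :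
    (g : PSL(2, F)) ^ 5 = 1 ↔ (g : Matrix (Fin 2) (Fin 2) F).trace ^ 4 -
      3 * (g : Matrix (Fin 2) (Fin 2) F).trace ^ 2 + 1 = 0 := by
  refine mk_pow_eq_one_iff_of_pow_eq hg (s := (g : Matrix (Fin 2) (Fin 2) F).trace ^ 3 -
    2 * (g : Matrix (Fin 2) (Fin 2) F).trace) ?_
  have h2 := coe_mul_self g
  generalize (g : Matrix (Fin 2) (Fin 2) F).trace = τ at *
  have h4 : (g : Matrix (Fin 2) (Fin 2) F) ^ 4 =
      (τ ^ 3 - 2 * τ) • (g : Matrix (Fin 2) (Fin 2) F) - (τ ^ 2 - 1) • 1 := by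
    rw [show 4 = 2 + 2 from rfl, pow_add, sq, h2]
    simp only [mul_sub, sub_mul, smul_mul_assoc, mul_smul_comm, h2, mul_one, one_mul]
    module
  rw [pow_succ, h4, sub_mul, smul_mul_assoc, h2, smul_mul_assoc, one_mul]
  module

end Lifts

/-- In a nontrivial image of `Δ`, the six words of the presentation are nontrivial. -/
lemma relations_ne_one {G : Type*} [Group G] {a b c : G} (ha : a ^ 3 = 1) (hb : b ^ 5 = 1)
    (hc : c ^ 3 = 1) (hab : (a * b) ^ 2 = 1) (hbc : (b * c) ^ 2 = 1) (habc : (a * b * c) ^ 2 = 1)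
    (h : ¬ (a = 1 ∧ b = 1 ∧ c = 1)) :
    a ≠ 1 ∧ b ≠ 1 ∧ c ≠ 1 ∧ a * b ≠ 1 ∧ b * c ≠ 1 ∧ a * b * c ≠ 1 := by
  have key : ∀ {g : G} (m n : ℕ), g ^ m = 1 → g ^ n = 1 → m.gcd n = 1 → g = 1 := by
    intro g m n h₁ h₂ hmn
    have := (pow_gcd_eq_one (a := g)).2 ⟨h₁, h₂⟩
    rwa [hmn, pow_one] at this
  have hb1 : b ≠ 1 := by
    rintro rfl
    exact h ⟨key 3 2 ha (by simpa using hab) rfl, rfl, key 3 2 hc (by simpa using hbc) rfl⟩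
  have hc1 : c ≠ 1 := by
    rintro rfl
    exact hb1 (key 5 2 hb (by simpa using hbc) rfl)
  refine ⟨?_, hb1, hc1, ?_, ?_, ?_⟩
  · rintro rfl
    exact hb1 (key 5 2 hb (by simpa using hab) rfl)
  · intro e
    rw [mul_eq_one_iff_inv_eq] at e
    exact hb1 (key 5 3 hb (show b ^ 3 = 1 by rw [← e, inv_pow, ha, inv_one]) rfl)
  · intro e
    rw [mul_eq_one_iff_eq_inv] at e
    exact hb1 (key 5 3 hb (show b ^ 3 = 1 by rw [e, inv_pow, hc, inv_one]) rfl)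
  · intro e
    rw [mul_eq_one_iff_inv_eq] at e
    exact hc1 (key 3 2 hc (show c ^ 2 = 1 by rw [← e, inv_pow, hab, inv_one]) rfl)

section Homs

variable {F : Type*} [Field F]

/-- The homomorphism from the free group to `SL(2, F)` given by three matrices. -/
def word (A B C : SL(2, F)) : FreeGroup (Fin 3) →* SL(2, F) := FreeGroup.lift ![A, B, C]

@[simp] lemma word_zero (A B C : SL(2, F)) : word A B C (FreeGroup.of 0) = A := by simp [word]
@[simp] lemma word_one (A B C : SL(2, F)) : word A B C (FreeGroup.of 1) = B := by simp [word]
@[simp] lemma word_two (A B C : SL(2, F)) : word A B C (FreeGroup.of 2) = C := by simp [word]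

lemma mk_of (i : Fin 3) :
    PresentedGroup.mk tetRelators (FreeGroup.of i) = PresentedGroup.of i := rfl

/-- `A, B, C` are lifts of the images of `α, β, γ` under `f`. -/
def IsLift (f : Tet →* PSL(2, F)) (A B C : SL(2, F)) : Prop :=
  ∀ w, f (PresentedGroup.mk tetRelators w) = (word A B C w : PSL(2, F))

lemma isLift_iff {f : Tet →* PSL(2, F)} {A B C : SL(2, F)} :
    IsLift f A B C ↔ f (PresentedGroup.of 0) = (A : PSL(2, F)) ∧
      f (PresentedGroup.of 1) = (B : PSL(2, F)) ∧ f (PresentedGroup.of 2) = (C : PSL(2, F)) := by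
  constructor
  · intro h
    have := fun i => h (FreeGroup.of i)
    simp only [mk_of] at this
    exact ⟨by simpa using this 0, by simpa using this 1, by simpa using this 2⟩
  · rintro ⟨h₀, h₁, h₂⟩ w
    have : f.comp (PresentedGroup.mk tetRelators) = (QuotientGroup.mk' _).comp (word A B C) := by
      ext i
      fin_cases i
      · simpa [mk_of] using h₀
      · simpa [mk_of] using h₁
      · simpa [mk_of] using h₂
    exact DFunLike.congr_fun this w

namespace TetTriple

variable {t x : F} {A B C : SL(2, F)}

lemma exists_isLift (h : TetTriple t x A.1 B.1 C.1) :
    ∃ f : Tet →* PSL(2, F), IsLift f A B C := by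
  have ht := h.sq
  have k2 : ∀ {g : SL(2, F)}, (g : Matrix (Fin 2) (Fin 2) F).trace = 0 →
      (g : PSL(2, F)) ^ 2 = 1 := by
    intro g hg
    by_cases h1 : (g : PSL(2, F)) = 1
    · simp [h1]
    · exact (mk_sq_eq_one_iff h1).2 hg
  have k3 : ∀ {g : SL(2, F)}, (g : Matrix (Fin 2) (Fin 2) F).trace = 1 →
      (g : PSL(2, F)) ^ 3 = 1 := by
    intro g hg
    by_cases h1 : (g : PSL(2, F)) = 1
    · simp [h1]
    · exact (mk_pow_three_eq_one_iff h1).2 (by rw [hg]; ring)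
  have k5 : (B : PSL(2, F)) ^ 5 = 1 := by
    by_cases h1 : (B : PSL(2, F)) = 1
    · simp [h1]
    · refine (mk_pow_five_eq_one_iff h1).2 ?_
      rw [h.trace_right]
      grind
  have hrel : ∀ r ∈ tetRelators,
      FreeGroup.lift ![(A : PSL(2, F)), (B : PSL(2, F)), (C : PSL(2, F))] r = 1 := by
    rintro r (rfl | rfl | rfl | rfl | rfl | rfl)
    · simpa using k3 h.trace_left
    · simpa using k5
    · simpa using k3 h.trace_third
    · simpa [← QuotientGroup.mk_mul] using k2 (g := A * B) (by simpa using h.trace_mul)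
    · simpa [← QuotientGroup.mk_mul] using k2 (g := B * C) (by simpa using h.trace_right_third)
    · simpa [← QuotientGroup.mk_mul] using k2 (g := A * B * C) (by simpa using h.trace_mul_third)
  refine ⟨PresentedGroup.toGroup hrel, isLift_iff.2 ⟨?_, ?_, ?_⟩⟩ <;> simp

end TetTriple

lemma exists_tetTriple {f : Tet →* PSL(2, F)} (hf : f ≠ 1) :
    ∃ (t x : F) (A B C : SL(2, F)), TetTriple t x A.1 B.1 C.1 ∧ IsLift f A B C := by
  have hrel : ∀ r ∈ tetRelators, f (PresentedGroup.mk tetRelators r) = 1 := fun r hr => by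
    rw [PresentedGroup.one_of_mem hr, map_one]
  generalize hφ : f.comp (PresentedGroup.mk tetRelators) = φ
  have hφi : ∀ i, φ (FreeGroup.of i) = f (PresentedGroup.of i) := fun i => by
    rw [← hφ, MonoidHom.comp_apply, mk_of]
  have hφr : ∀ r ∈ tetRelators, φ r = 1 := fun r hr => by rw [← hφ]; exact hrel r hr
  simp only [tetRelators, Set.mem_insert_iff, Set.mem_singleton_iff, forall_eq_or_imp, forall_eq,
    map_mul, map_pow, hφi] at hφr
  obtain ⟨ha, hb, hc, hab, hbc, habc⟩ := hφr
  obtain ⟨na, nb, nc, nab, nbc, nabc⟩ := relations_ne_one ha hb hc hab hbc habc (by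
    rintro ⟨h₀, h₁, h₂⟩
    apply hf
    ext i
    fin_cases i <;> assumption)
  have k3 : ∀ {a : PSL(2, F)}, a ≠ 1 → a ^ 3 = 1 →
      ∃ A : SL(2, F), (A : Matrix (Fin 2) (Fin 2) F).trace = 1 ∧ a = A := by
    intro a
    induction a using QuotientGroup.induction_on with | H A => ?_
    intro na ha
    rw [mk_pow_three_eq_one_iff na, sub_eq_zero, sq_eq_one_iff] at ha
    obtain ha | ha := ha
    · exact ⟨A, ha, rfl⟩
    · exact ⟨-A, by rw [trace_neg_coe, ha, neg_neg], (mk_neg A).symm⟩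
  have k5 : ∀ {a : PSL(2, F)}, a ≠ 1 → a ^ 5 = 1 →
      ∃ A : SL(2, F), (A : Matrix (Fin 2) (Fin 2) F).trace ^ 2 =
        (A : Matrix (Fin 2) (Fin 2) F).trace + 1 ∧ a = A := by
    intro a
    induction a using QuotientGroup.induction_on with | H A => ?_
    intro na ha
    rw [mk_pow_five_eq_one_iff na] at ha
    generalize hτ : (A : Matrix (Fin 2) (Fin 2) F).trace = τ at *
    have : (τ ^ 2 - (τ + 1)) * (τ ^ 2 - (-τ + 1)) = 0 := by rw [← ha]; ring
    obtain ha | ha := mul_eq_zero.1 this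
    · exact ⟨A, by rw [hτ]; exact sub_eq_zero.1 ha, rfl⟩
    · exact ⟨-A, by rw [trace_neg_coe, hτ, neg_sq]; exact sub_eq_zero.1 ha, (mk_neg A).symm⟩
  obtain ⟨A, tA, hA⟩ := k3 na ha
  obtain ⟨B, tB, hB⟩ := k5 nb hb
  obtain ⟨C, tC, hC⟩ := k3 nc hc
  rw [hA, hB, ← QuotientGroup.mk_mul] at hab nab
  rw [hB, hC, ← QuotientGroup.mk_mul] at hbc nbc
  rw [hA, hB, hC, ← QuotientGroup.mk_mul, ← QuotientGroup.mk_mul] at habc nabc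
  rw [mk_sq_eq_one_iff nab] at hab
  rw [mk_sq_eq_one_iff nbc] at hbc
  rw [mk_sq_eq_one_iff nabc] at habc
  exact ⟨B.1.trace, (A.1 * C.1).trace, A, B, C,
    { det_left := A.2, det_right := B.2, trace_left := tA, trace_right := rfl, sq := tB,
      trace_mul := by simpa using hab, det_third := C.2, trace_third := tC,
      trace_right_third := by simpa using hbc, trace_left_third := rfl,
      trace_mul_third := by simpa using habc }, isLift_iff.2 ⟨hA, hB, hC⟩⟩

end Homs

section Kernels

lemma Rules.freeGroup_mem_of_fin_three {k R : Type*} [CommRing k] [Ring R] [Algebra k R] {t : k}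
    {a b : R} (h : Rules t a b) (φ : FreeGroup (Fin 3) →* R) {d : Fin 4 → k}
    (h₀ : φ (FreeGroup.of 0) = a) (h₁ : φ (FreeGroup.of 1) = b)
    (h₂ : φ (FreeGroup.of 2) = comb a b d)
    (hd : comb a b d * comb a b d = comb a b d - 1) (w : FreeGroup (Fin 3)) :
    ∃ c : Fin 4 → k, φ w = comb a b c := by
  have inv : ∀ {i : Fin 3} {y z : R}, φ (FreeGroup.of i) = y → y * z = 1 →
      φ (FreeGroup.of i)⁻¹ = z := by
    intro i y z hy hyz
    refine left_inv_eq_right_inv (a := y) ?_ hyz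
    rw [← hy, ← map_mul, inv_mul_cancel, map_one]
  refine h.freeGroup_mem φ (fun i => ?_) w
  fin_cases i
  · refine ⟨⟨_, h₀.trans (comb_left (k := k)).symm⟩, ![1, -1, 0, 0], inv h₀ ?_⟩
    simp [comb, ← sub_eq_add_neg, mul_sub, h.aa]
  · refine ⟨⟨_, h₁.trans (comb_right (k := k)).symm⟩, ![t, 0, -1, 0], inv h₁ ?_⟩
    simp [comb, ← sub_eq_add_neg, mul_sub, h.bb]
  · refine ⟨⟨_, h₂⟩, ![1, 0, 0, 0] + (-1 : k) • d, inv h₂ ?_⟩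
    rw [← comb_add, ← comb_smul, comb_one, mul_add, mul_smul_comm, hd]
    simp

variable {F : Type*} [Field F]

lemma TetPair.map {K : Type*} [Field K] {t : F} {A B : SL(2, F)} (σ : F →+* K)
    (h : TetPair t A.1 B.1) : TetPair (σ t) (A.map σ).1 (B.map σ).1 := by
  have tr : ∀ M : Matrix (Fin 2) (Fin 2) F, (σ.mapMatrix M).trace = σ M.trace := fun M =>
    (AddMonoidHom.map_trace σ M).symm
  constructor
  · exact (A.map σ).2
  · exact (B.map σ).2
  · simp only [Matrix.SpecialLinearGroup.map_apply_coe, tr, h.trace_left, map_one]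
  · simp only [Matrix.SpecialLinearGroup.map_apply_coe, tr, h.trace_right]
  · simp only [Matrix.SpecialLinearGroup.map_apply_coe, ← map_mul, tr, h.trace_mul, map_zero]
  · rw [← map_pow, h.sq, map_add, map_one]

lemma TetTriple.third_mul_self {t x : F} {A B C : Matrix (Fin 2) (Fin 2) F}
    (h : TetTriple t x A B C) : C * C = C - 1 := by
  rw [mul_self_eq, h.trace_third, h.det_third, one_smul, one_smul]

/-- The homomorphism from the free group to the ring of matrices. -/
def matWord (A B C : SL(2, F)) : FreeGroup (Fin 3) →* Matrix (Fin 2) (Fin 2) F where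
  toFun w := (word A B C w : Matrix (Fin 2) (Fin 2) F)
  map_one' := by simp
  map_mul' := by simp

lemma matWord_apply (A B C : SL(2, F)) (w : FreeGroup (Fin 3)) :
    matWord A B C w = (word A B C w : Matrix (Fin 2) (Fin 2) F) := rfl

lemma comb_prod {k R S : Type*} [CommRing k] [Ring R] [Algebra k R] [Ring S] [Algebra k S]
    (a b : R) (a' b' : S) (c : Fin 4 → k) :
    comb (a, a') (b, b') c = (comb a b c, comb a' b' c) := rfl

namespace TetTriple

variable {t x : F} {A B C A' B' C' : SL(2, F)}

lemma exists_comb_word (h : TetTriple t x A.1 B.1 C.1) (h' : TetTriple t x A'.1 B'.1 C'.1)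
    (w : FreeGroup (Fin 3)) : ∃ c : Fin 4 → F,
      (word A B C w).1 = comb A.1 B.1 c ∧ (word A' B' C' w).1 = comb A'.1 B'.1 c := by
  have hr : Rules t (A.1, A'.1) (B.1, B'.1) :=
    ⟨Prod.ext h.rules.aa h'.rules.aa, Prod.ext h.rules.bb h'.rules.bb,
      Prod.ext h.rules.ba h'.rules.ba⟩
  have e : comb (A.1, A'.1) (B.1, B'.1) (thirdCoeff t x) = (C.1, C'.1) := by
    rw [comb_prod, ← h.third_eq, ← h'.third_eq]
  obtain ⟨c, hc⟩ := hr.freeGroup_mem_of_fin_three ((matWord A B C).prod (matWord A' B' C'))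
    (d := thirdCoeff t x) (by simp [matWord_apply]) (by simp [matWord_apply])
    (by rw [e]; simp [matWord_apply])
    (by rw [e]; exact Prod.ext h.third_mul_self h'.third_mul_self) w
  rw [comb_prod, Prod.ext_iff] at hc
  exact ⟨c, hc⟩

lemma word_eq_one_or_neg_one_of (h : TetTriple t x A.1 B.1 C.1)
    (h' : TetTriple t x A'.1 B'.1 C'.1) {w : FreeGroup (Fin 3)}
    (hw : word A B C w = 1 ∨ word A B C w = -1) :
    word A' B' C' w = 1 ∨ word A' B' C' w = -1 := by
  obtain ⟨c, hc, hc'⟩ := h.exists_comb_word h' w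
  have key : ∀ {P Q : Matrix (Fin 2) (Fin 2) F} {r : F},
      comb P Q (r • ![1, 0, 0, 0] : Fin 4 → F) = r • 1 := by
    intro P Q r
    rw [← comb_smul, comb_one]
  refine hw.imp (fun e => ?_) (fun e => ?_) <;> rw [e] at hc
  · have : c = (1 : F) • ![1, 0, 0, 0] := h.comb_injective (by rw [← hc, key]; simp)
    exact Subtype.ext (by rw [hc', this, key]; simp)
  · have : c = (-1 : F) • ![1, 0, 0, 0] := h.comb_injective (by rw [← hc, key]; simp)
    exact Subtype.ext (by rw [hc', this, key]; simp)

lemma map {K : Type*} [Field K] (σ : F →+* K) (h : TetTriple t x A.1 B.1 C.1) :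
    TetTriple (σ t) (σ x) (A.map σ).1 (B.map σ).1 (C.map σ).1 := by
  have tr : ∀ M : Matrix (Fin 2) (Fin 2) F, (σ.mapMatrix M).trace = σ M.trace := fun M =>
    (AddMonoidHom.map_trace σ M).symm
  constructor
  · exact h.toTetPair.map σ
  · exact (C.map σ).2
  · simp only [Matrix.SpecialLinearGroup.map_apply_coe, tr, h.trace_third, map_one]
  · simp only [Matrix.SpecialLinearGroup.map_apply_coe, ← map_mul, tr, h.trace_right_third,
      map_zero]
  · simp only [Matrix.SpecialLinearGroup.map_apply_coe, ← map_mul, tr, h.trace_left_third]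
  · simp only [Matrix.SpecialLinearGroup.map_apply_coe, ← map_mul, tr, h.trace_mul_third,
      map_zero]

end TetTriple

lemma word_map {K : Type*} [Field K] (σ : F →+* K) (A B C : SL(2, F)) (w : FreeGroup (Fin 3)) :
    word (A.map σ) (B.map σ) (C.map σ) w = (word A B C w).map σ := by
  suffices word (A.map σ) (B.map σ) (C.map σ) =
    (Matrix.SpecialLinearGroup.map σ).comp (word A B C) from DFunLike.congr_fun this w
  ext1 i
  fin_cases i <;> simp

lemma IsLift.mem_ker_iff {f : Tet →* PSL(2, F)} {A B C : SL(2, F)} (h : IsLift f A B C)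
    {w : FreeGroup (Fin 3)} : PresentedGroup.mk tetRelators w ∈ f.ker ↔
      word A B C w = 1 ∨ word A B C w = -1 := by
  rw [MonoidHom.mem_ker, h w, mk_eq_one_iff]

/-- The kernel is determined by the field parameters up to a field endomorphism. -/
lemma TetTriple.ker_eq {t x : F} {A B C A' B' C' : SL(2, F)} {f f' : Tet →* PSL(2, F)}
    (σ : F →+* F) (h : TetTriple t x A.1 B.1 C.1) (hf : IsLift f A B C)
    (h' : TetTriple (σ t) (σ x) A'.1 B'.1 C'.1) (hf' : IsLift f' A' B' C') : f.ker = f'.ker := by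
  ext g
  obtain ⟨w, rfl⟩ := PresentedGroup.mk_surjective tetRelators g
  have e : word A B C w = 1 ∨ word A B C w = -1 ↔
      word (A.map σ) (B.map σ) (C.map σ) w = 1 ∨ word (A.map σ) (B.map σ) (C.map σ) w = -1 := by
    have inj : Function.Injective (Matrix.SpecialLinearGroup.map (n := Fin 2) σ) := by
      intro P Q hPQ
      ext i j
      exact σ.injective (congrArg (fun M : SL(2, F) => M i j) hPQ)
    rw [word_map, ← inj.eq_iff, ← inj.eq_iff (b := -1), map_one]
    rw [show Matrix.SpecialLinearGroup.map σ (-1 : SL(2, F)) = -1 by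
      ext i j; simp [one_apply, apply_ite σ]]
  rw [hf.mem_ker_iff, hf'.mem_ker_iff, e]
  exact ⟨(h.map σ).word_eq_one_or_neg_one_of h', h'.word_eq_one_or_neg_one_of (h.map σ)⟩

/-- If the parameters lie in a proper subfield then the homomorphism is not surjective. -/
lemma TetTriple.not_surjective {k : Type*} [Field k] [Algebra k F] {t x : k} {A B C : SL(2, F)}
    {f : Tet →* PSL(2, F)} (h : TetTriple (algebraMap k F t) (algebraMap k F x) A.1 B.1 C.1)
    (hf : IsLift f A B C) (hF : ¬ Function.Surjective (algebraMap k F)) :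
    ¬ Function.Surjective f := by
  intro hs
  apply hF
  have hc : ∀ c : Fin 4 → k, comb A.1 B.1 (algebraMap k F ∘ c) = comb A.1 B.1 c := by
    intro c
    simp [comb]
  have ht : algebraMap k F ∘ thirdCoeff t x =
      thirdCoeff (algebraMap k F t) (algebraMap k F x) := by
    ext i
    fin_cases i <;> simp [thirdCoeff, map_ofNat (algebraMap k F)]
  have hr : Rules t A.1 B.1 := by
    obtain ⟨h₁, h₂, h₃⟩ := h.rules
    simp only [algebraMap_smul] at h₂ h₃
    exact ⟨h₁, h₂, h₃⟩
  have e : C.1 = comb A.1 B.1 (thirdCoeff t x) := by rw [h.third_eq, ← ht, hc]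
  intro y
  let Y : SL(2, F) := ⟨!![0, -1; 1, y], by simp [det_fin_two]⟩
  have hY : Y.1.trace = y := by simp [Y, trace_fin_two]
  obtain ⟨g, hg⟩ := hs (Y : PSL(2, F))
  obtain ⟨w, rfl⟩ := PresentedGroup.mk_surjective tetRelators g
  rw [hf w, mk_eq_mk_iff] at hg
  obtain ⟨c, hw⟩ := hr.freeGroup_mem_of_fin_three (matWord A B C) (d := thirdCoeff t x)
    (by simp [matWord_apply]) (by simp [matWord_apply])
    (by simp [matWord_apply, e]) (by rw [← e]; exact h.third_mul_self) w
  have htr := congrArg trace hw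
  rw [← hc, h.trace_comb, matWord_apply] at htr
  obtain hg | hg := hg
  · refine ⟨2 * c 0 + c 1 + t * c 2, ?_⟩
    rw [hg, hY] at htr
    simp only [map_add, map_mul, map_ofNat, htr, Function.comp_apply]
  · refine ⟨-(2 * c 0 + c 1 + t * c 2), ?_⟩
    rw [hg, trace_neg_coe, hY] at htr
    simp only [map_neg, map_add, map_mul, map_ofNat]
    exact (neg_eq_iff_eq_neg.1 htr).symm

end Kernels

section Elementary

variable {F : Type*} [Field F]

/-- The upper unitriangular matrix with off-diagonal entry `x`. -/
def upper (x : F) : SL(2, F) := ⟨!![1, x; 0, 1], by simp [det_fin_two]⟩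

/-- The lower unitriangular matrix with off-diagonal entry `x`. -/
def lower (x : F) : SL(2, F) := ⟨!![1, 0; x, 1], by simp [det_fin_two]⟩

lemma coe_upper (x : F) : (upper x : Matrix (Fin 2) (Fin 2) F) = !![1, x; 0, 1] := rfl

lemma coe_lower (x : F) : (lower x : Matrix (Fin 2) (Fin 2) F) = !![1, 0; x, 1] := rfl

lemma upper_zero : upper (0 : F) = 1 := Subtype.ext (by simp [coe_upper, one_fin_two])

lemma lower_zero : lower (0 : F) = 1 := Subtype.ext (by simp [coe_lower, one_fin_two])

lemma upper_add (x y : F) : upper (x + y) = upper x * upper y :=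
  Subtype.ext (by simp [coe_upper, add_comm])

lemma lower_add (x y : F) : lower (x + y) = lower x * lower y :=
  Subtype.ext (by simp [coe_lower])

lemma upper_neg (x : F) : upper (-x) = (upper x)⁻¹ := by
  rw [eq_inv_iff_mul_eq_one, ← upper_add, neg_add_cancel, upper_zero]

lemma lower_neg (x : F) : lower (-x) = (lower x)⁻¹ := by
  rw [eq_inv_iff_mul_eq_one, ← lower_add, neg_add_cancel, lower_zero]

/-- The parameters of the upper unitriangular matrices in a subgroup. -/
def upperSubgroup (H : Subgroup SL(2, F)) : AddSubgroup F where
  carrier := {x | upper x ∈ H}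
  zero_mem' := by simp [upper_zero]
  add_mem' hx hy := by rw [Set.mem_ofPred, upper_add]; exact mul_mem hx hy
  neg_mem' hx := by rw [Set.mem_ofPred, upper_neg]; exact inv_mem hx

/-- The parameters of the lower unitriangular matrices in a subgroup. -/
def lowerSubgroup (H : Subgroup SL(2, F)) : AddSubgroup F where
  carrier := {x | lower x ∈ H}
  zero_mem' := by simp [lower_zero]
  add_mem' hx hy := by rw [Set.mem_ofPred, lower_add]; exact mul_mem hx hy
  neg_mem' hx := by rw [Set.mem_ofPred, lower_neg]; exact inv_mem hx

lemma coe_product (m i k j μ : F) :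
    ((lower m * upper i * lower k * upper j * lower μ : SL(2, F)) : Matrix (Fin 2) (Fin 2) F) =
      !![1 + j * μ + i * (μ + k * (1 + j * μ)), j + i * (1 + k * j);
        m * (1 + j * μ + i * (μ + k * (1 + j * μ))) + (μ + k * (1 + j * μ)),
        m * (j + i * (1 + k * j)) + (1 + k * j)] := by
  ext a b
  fin_cases a <;> fin_cases b <;> simp [coe_upper, coe_lower] <;> ring

lemma eq_top_of_upper_lower {H : Subgroup SL(2, F)} (hu : ∀ x, upper x ∈ H)
    (hl : ∀ x, lower x ∈ H) : H = ⊤ := by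
  have key : ∀ g : SL(2, F), g 1 0 ≠ 0 → g ∈ H := by
    intro g hg
    have hd := g.det_coe
    rw [det_fin_two] at hd
    have : g = upper ((g 0 0 - 1) / g 1 0) * lower (g 1 0) * upper ((g 1 1 - 1) / g 1 0) := by
      ext i j
      fin_cases i <;> fin_cases j <;>
        simp [coe_upper, coe_lower, mul_apply, Fin.sum_univ_two] <;> field_simp <;> grind
    rw [this]
    exact mul_mem (mul_mem (hu _) (hl _)) (hu _)
  rw [eq_top_iff]
  intro g _
  by_cases hg : g 1 0 = 0
  · rw [← Subgroup.mul_mem_cancel_right H (hl 1)]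
    apply key
    have hd := g.det_coe
    rw [det_fin_two, hg] at hd
    have : g 1 1 ≠ 0 := by grind
    simpa [coe_lower, mul_apply, Fin.sum_univ_two, hg] using this
  · exact key g hg

/-- Conjugation by an invertible matrix. -/
def conj (M : GL (Fin 2) F) : SL(2, F) →* SL(2, F) where
  toFun g := ⟨(M : Matrix (Fin 2) (Fin 2) F) * g.1 * (M⁻¹ : GL (Fin 2) F), by
    rw [det_mul_right_comm, Units.mul_inv, one_mul, g.2]⟩
  map_one' := Subtype.ext (by simp)
  map_mul' g h := Subtype.ext (by
    change M.1 * (g.1 * h.1) * M⁻¹.1 = (M.1 * g.1 * M⁻¹.1) * (M.1 * h.1 * M⁻¹.1)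
    simp [mul_assoc])

lemma coe_conj (M : GL (Fin 2) F) (g : SL(2, F)) : (conj M g : Matrix (Fin 2) (Fin 2) F) =
    (M : Matrix (Fin 2) (Fin 2) F) * g.1 * (M⁻¹ : GL (Fin 2) F) := rfl

lemma conj_conj_inv (M : GL (Fin 2) F) (g : SL(2, F)) : conj M (conj M⁻¹ g) = g :=
  Subtype.ext (by simp [coe_conj, mul_assoc])

lemma trace_conj (M : GL (Fin 2) F) (g : SL(2, F)) :
    (conj M g : Matrix (Fin 2) (Fin 2) F).trace = g.1.trace := by
  rw [coe_conj, trace_mul_comm, ← mul_assoc, Units.inv_mul, one_mul]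

lemma eq_top_of_comap_conj {H : Subgroup SL(2, F)} (M : GL (Fin 2) F)
    (h : H.comap (conj M) = ⊤) : H = ⊤ := by
  rw [eq_top_iff]
  intro g _
  rw [← conj_conj_inv M g]
  exact (h ▸ Subgroup.mem_top (conj M⁻¹ g) : conj M⁻¹ g ∈ H.comap (conj M))

/-- Two nilpotent matrices whose product has nonzero trace can be brought simultaneously into
strictly upper and strictly lower triangular form. -/
lemma exists_conj_eq {N N' : Matrix (Fin 2) (Fin 2) F} (h₀ : N.trace = 0) (hd : N.det = 0)
    (h₀' : N'.trace = 0) (hd' : N'.det = 0) {μ : F} (hμ : (N * N').trace = μ) (hμ0 : μ ≠ 0) :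
    ∃ M : GL (Fin 2) F, N * M.1 = M.1 * !![0, 1; 0, 0] ∧ N' * M.1 = M.1 * !![0, 0; μ, 0] := by
  obtain ⟨a, b, c, d, rfl⟩ : ∃ a b c d, N = !![a, b; c, d] := ⟨_, _, _, _, eta_fin_two N⟩
  obtain ⟨a', b', c', d', rfl⟩ : ∃ a b c d, N' = !![a, b; c, d] := ⟨_, _, _, _, eta_fin_two N'⟩
  simp [trace_fin_two, det_fin_two] at h₀ hd h₀' hd' hμ
  have key : ∀ p q : F, a' * p + b' * q = 0 → c' * p + d' * q = 0 →
      (a * p + b * q) * q - (c * p + d * q) * p ≠ 0 →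
      ∃ M : GL (Fin 2) F, !![a, b; c, d] * M.1 = M.1 * !![0, 1; 0, 0] ∧
        !![a', b'; c', d'] * M.1 = M.1 * !![0, 0; μ, 0] := by
    intro p q h₁ h₂ h₃
    have hM : !![a * p + b * q, p; c * p + d * q, q].det ≠ 0 := by
      rw [det_fin_two]
      simp
      intro h
      exact h₃ (by rw [← h]; ring)
    refine ⟨GeneralLinearGroup.mkOfDetNeZero _ hM, ?_, ?_⟩
    · ext i j
      fin_cases i <;> fin_cases j <;> simp [GeneralLinearGroup.mkOfDetNeZero] <;> grind
    · ext i j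
      fin_cases i <;> fin_cases j <;> simp [GeneralLinearGroup.mkOfDetNeZero] <;> grind
  by_cases hc : c' = 0
  · by_cases hb : b' = 0
    · grind
    · refine key b' (-a') (by ring) (by grind) fun h => ?_
      have : b' * μ = 0 := by grind
      grind
  · refine key a' c' (by grind) (by grind) fun h => ?_
    have : c' * μ = 0 := by grind
    grind

end Elementary

section PrimeField

variable {F : Type*} [Field F] {p : ℕ} [Fact p.Prime] [Algebra (ZMod p) F]

lemma smul_mem_upper {H : Subgroup SL(2, F)} {x : F} (hx : upper x ∈ H) (k : ZMod p) :
    upper (k • x) ∈ H :=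
  ((upperSubgroup H).toZModSubmodule p).smul_mem k hx

lemma smul_mem_lower {H : Subgroup SL(2, F)} {x : F} (hx : lower x ∈ H) (k : ZMod p) :
    lower (k • x) ∈ H :=
  ((lowerSubgroup H).toZModSubmodule p).smul_mem k hx

lemma algebraMap_mem_upper {H : Subgroup SL(2, F)} (hx : upper (1 : F) ∈ H) (k : ZMod p) :
    upper (algebraMap (ZMod p) F k) ∈ H := by
  rw [Algebra.algebraMap_eq_smul_one]
  exact smul_mem_upper hx k

lemma eq_top_of_upper_one {H : Subgroup SL(2, ZMod p)} (hu : upper 1 ∈ H) {μ : ZMod p}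
    (hμ : μ ≠ 0) (hl : lower μ ∈ H) : H = ⊤ := by
  refine eq_top_of_upper_lower (fun x => ?_) fun x => ?_
  · simpa using smul_mem_upper hu x
  · simpa [div_mul_cancel₀ _ hμ] using smul_mem_lower hl (x / μ)

lemma exists_eq_add_smul (hF : Module.finrank (ZMod p) F = 2) {y : F}
    (hy : ∀ k : ZMod p, algebraMap _ F k ≠ y) (z : F) :
    ∃ a b : ZMod p, z = algebraMap _ F a + b • y := by
  have hli : LinearIndependent (ZMod p) ![1, y] := by
    rw [LinearIndependent.pair_iff' one_ne_zero]
    intro a h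
    exact hy a (by rw [← h, Algebra.algebraMap_eq_smul_one])
  have := hli.span_eq_top_of_card_eq_finrank (by simp [hF])
  have hz : z ∈ Submodule.span (ZMod p) (Set.range ![1, y]) := this ▸ Submodule.mem_top
  simp only [range_cons, range_empty, Set.union_empty, Set.singleton_union] at hz
  obtain ⟨a, b, h⟩ := Submodule.mem_span_pair.1 hz
  exact ⟨a, b, by rw [← h, Algebra.algebraMap_eq_smul_one]⟩

/-- A quadratic case of a theorem of Dickson. -/
lemma eq_top_of_upper_one_of_finrank (hF : Module.finrank (ZMod p) F = 2) (h2 : (2 : ZMod p) ≠ 0)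
    (h3 : (3 : ZMod p) ≠ 0) {H : Subgroup SL(2, F)} (hu : upper 1 ∈ H) {μ : F}
    (hμ : ∀ k : ZMod p, algebraMap _ F k ≠ μ) (hl : lower μ ∈ H) : H = ⊤ := by
  have hμ0 : μ ≠ 0 := fun h => hμ 0 (by rw [h, map_zero])
  have reduction : ∀ j k : ZMod p, j ≠ 0 → k ≠ 0 →
      (∀ i : ZMod p, algebraMap _ F i ≠ (1 + k • (1 + j • μ)) ^ 2) →
      (∀ i : ZMod p, 1 + j • μ ≠ i • μ * (1 + k • (1 + j • μ))) → ∀ x, upper x ∈ H := by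
    intro j k hj hk hD hi
    set D := 1 + k • (1 + j • μ) with hDdef
    have hD0 : D ≠ 0 := fun h => hD 0 (by simp [h])
    obtain ⟨c, i, hci⟩ := exists_eq_add_smul hF hμ ((1 + j • μ) / D)
    rw [div_eq_iff hD0] at hci
    have hc : c ≠ 0 := by
      rintro rfl
      exact hi i (by rw [hci, map_zero, zero_add])
    have hc' : algebraMap (ZMod p) F c ≠ 0 := by simpa using hc
    let g := lower (-(c⁻¹ • μ)) * upper (-algebraMap _ F i) * lower (k • μ) *
      upper (algebraMap _ F j) * lower μ
    have hg : g ∈ H := by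
      refine mul_mem (mul_mem (mul_mem (mul_mem ?_ ?_) ?_) ?_) hl
      · rw [lower_neg]; exact inv_mem (smul_mem_lower hl _)
      · rw [upper_neg]; exact inv_mem (algebraMap_mem_upper hu _)
      · exact smul_mem_lower hl _
      · exact algebraMap_mem_upper hu _
    simp only [Algebra.smul_def] at hci hDdef hD
    have g00 : g 0 0 = algebraMap _ F c * D := by
      simp only [g, Algebra.smul_def, coe_product]
      simp only [of_apply, cons_val]
      linear_combination hci + algebraMap _ F i * μ * hDdef
    have g10 : g 1 0 = 0 := by
      simp only [g, Algebra.smul_def, coe_product]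
      simp only [of_apply, cons_val, map_inv₀]
      have hX : 1 + algebraMap _ F j * μ + -algebraMap _ F i * (μ + algebraMap _ F k * μ *
          (1 + algebraMap _ F j * μ)) = algebraMap _ F c * D := by
        linear_combination hci + algebraMap _ F i * μ * hDdef
      rw [hX, hDdef]
      field_simp
      ring
    have hconj : g * upper 1 * g⁻¹ = upper ((algebraMap _ F c * D) ^ 2) := by
      rw [mul_inv_eq_iff_eq_mul]
      have hd := g.det_coe
      rw [det_fin_two, g10, g00] at hd
      ext a b
      fin_cases a <;> fin_cases b <;>
        simp [coe_upper, mul_apply, Fin.sum_univ_two, g00, g10]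
      grind
    have hmem : upper ((algebraMap _ F c * D) ^ 2) ∈ H := by
      rw [← hconj]
      exact mul_mem (mul_mem hg hu) (inv_mem hg)
    intro x
    obtain ⟨a, b, rfl⟩ := exists_eq_add_smul hF (y := (algebraMap _ F c * D) ^ 2) (fun e he => by
      apply hD (e / c ^ 2)
      rw [map_div₀, map_pow, he]
      field_simp) x
    rw [upper_add]
    exact mul_mem (algebraMap_mem_upper hu a) (smul_mem_upper hmem b)
  have hu' : ∀ x, upper x ∈ H := by
    obtain ⟨ν, τ, hντ⟩ := exists_eq_add_smul hF hμ (μ ^ 2)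
    have uniq : ∀ {a b : ZMod p}, algebraMap _ F a + algebraMap _ F b * μ = 0 → a = 0 ∧ b = 0 := by
      intro a b h
      have hb : b = 0 := by
        by_contra hb
        apply hμ (-a / b)
        have : algebraMap (ZMod p) F b ≠ 0 := by simpa using hb
        rw [map_div₀, map_neg]
        field_simp
        linear_combination -h
      subst hb
      simpa using h
    have hν : ν ≠ 0 := by
      rintro rfl
      apply hμ τ
      rw [Algebra.smul_def] at hντ
      apply mul_right_cancel₀ hμ0
      rw [map_zero] at hντ
      linear_combination -hντ
    rw [Algebra.smul_def] at hντ
    by_cases hτ : τ = 0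
    · obtain ⟨j, hj, hj'⟩ : ∃ j : ZMod p, j ≠ 0 ∧ j ^ 2 * ν ≠ 2 := by
        by_cases h : ν = 2
        · refine ⟨2, h2, fun h' => mul_ne_zero h2 h3 ?_⟩
          rw [h] at h'
          linear_combination h'
        · exact ⟨1, one_ne_zero, by simpa using h⟩
      refine reduction j 1 hj one_ne_zero (fun i hi => ?_) fun i hi => ?_
      · simp only [Algebra.smul_def, map_one] at hi
        have := @uniq (4 + j ^ 2 * ν - i) (4 * j) (by
          simp only [map_sub, map_add, map_mul, map_pow, map_ofNat]
          simp only [hτ, map_zero] at hντ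
          linear_combination -hi - algebraMap _ F j ^ 2 * hντ)
        exact mul_ne_zero (mul_ne_zero h2 h2) hj (by linear_combination this.2)
      · simp only [Algebra.smul_def, map_one] at hi
        have := @uniq (1 - i * j * ν) (j - 2 * i) (by
          simp only [map_sub, map_mul, map_one, map_ofNat]
          simp only [hτ, map_zero] at hντ
          linear_combination hi + algebraMap _ F i * algebraMap _ F j * hντ)
        clear reduction uniq hμ
        grind
    · obtain ⟨j, hj, hj'⟩ : ∃ j : ZMod p, j ≠ 0 ∧ j * ν ≠ τ := by
        by_cases h : ν = τ
        · exact ⟨2, h2, by grind⟩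
        · exact ⟨1, one_ne_zero, by simpa using h⟩
      refine reduction j (-1) hj (by simp) (fun i hi => ?_) fun i hi => ?_
      · simp only [Algebra.smul_def, map_one, map_neg] at hi
        have := @uniq (j ^ 2 * ν - i) (j ^ 2 * τ) (by
          simp only [map_sub, map_mul, map_pow]
          linear_combination -hi - algebraMap _ F j ^ 2 * hντ)
        clear reduction uniq hμ
        grind
      · simp only [Algebra.smul_def, map_one, map_neg] at hi
        have := @uniq (1 + i * j * ν) (j + i * j * τ) (by
          simp only [map_add, map_mul, map_one]
          linear_combination hi - algebraMap _ F i * algebraMap _ F j * hντ)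
        clear reduction uniq hμ
        grind
  refine eq_top_of_upper_lower hu' fun x => ?_
  let w : SL(2, F) := upper (-μ⁻¹) * lower μ * upper (-μ⁻¹)
  have hw : w ∈ H := mul_mem (mul_mem (hu' _) hl) (hu' _)
  have : lower x = w * upper (-x / μ ^ 2) * w⁻¹ := by
    rw [eq_mul_inv_iff_mul_eq]
    ext a b
    fin_cases a <;> fin_cases b <;>
      simp [w, coe_upper, coe_lower, mul_apply, Fin.sum_univ_two, hμ0]
    field_simp
  rw [this]
  exact mul_mem (mul_mem hw (hu' _)) (inv_mem hw)

end PrimeField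

section Automorphisms

variable {F : Type*} [Field F]

lemma upper_pow (x : F) (n : ℕ) : upper x ^ n = upper (n • x) := by
  induction n with
  | zero => simp [upper_zero]
  | succ n ih => rw [pow_succ, ih, succ_nsmul, upper_add]

lemma lower_pow (x : F) (n : ℕ) : lower x ^ n = lower (n • x) := by
  induction n with
  | zero => simp [lower_zero]
  | succ n ih => rw [pow_succ, ih, succ_nsmul, lower_add]

variable {p : ℕ} [Fact p.Prime]

lemma trace_det_sub_one [CharP F p] {g : SL(2, F)} (hg : g ^ p = 1) :
    (g.1 - 1).trace = 0 ∧ (g.1 - 1).det = 0 := by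
  have h : (g.1 - 1) ^ p = 0 := by
    rw [sub_pow_char_of_commute p (Commute.one_right g.1), one_pow, sub_eq_zero,
      ← Matrix.SpecialLinearGroup.coe_pow, hg, Matrix.SpecialLinearGroup.coe_one]
  refine ⟨(isNilpotent_trace_of_isNilpotent ⟨p, h⟩).eq_zero, ?_⟩
  have := congrArg det h
  rw [det_pow, det_zero] at this
  · exact eq_zero_of_pow_eq_zero this

lemma eq_conj_upper {M : GL (Fin 2) F} {g : SL(2, F)} {x : F}
    (h : (g.1 - 1) * M.1 = M.1 * !![0, x; 0, 0]) : g = conj M (upper x) := by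
  apply Subtype.ext
  rw [coe_conj, coe_upper, Units.eq_mul_inv_iff_mul_eq]
  have : (!![1, x; 0, 1] : Matrix (Fin 2) (Fin 2) F) = 1 + !![0, x; 0, 0] := by
    simp [one_fin_two]
  rw [this, mul_add, ← h, mul_one, sub_mul, one_mul, add_sub_cancel]

lemma eq_conj_lower {M : GL (Fin 2) F} {g : SL(2, F)} {x : F}
    (h : (g.1 - 1) * M.1 = M.1 * !![0, 0; x, 0]) : g = conj M (lower x) := by
  apply Subtype.ext
  rw [coe_conj, coe_lower, Units.eq_mul_inv_iff_mul_eq]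
  have : (!![1, 0; x, 1] : Matrix (Fin 2) (Fin 2) F) = 1 + !![0, 0; x, 0] := by
    simp [one_fin_two]
  rw [this, mul_add, ← h, mul_one, sub_mul, one_mul, add_sub_cancel]

variable [Algebra (ZMod p) F]

/-- An automorphism of `PSL(2, F)` agrees on the image of `SL(2, p)` with conjugation by an
invertible matrix. -/
lemma exists_conj_of_mulEquiv (hp : p ≠ 2) (φ : PSL(2, F) ≃* PSL(2, F)) :
    ∃ M : GL (Fin 2) F, ∀ g : SL(2, ZMod p), φ (g.map (algebraMap (ZMod p) F) : SL(2, F)) =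
      (conj M (g.map (algebraMap (ZMod p) F)) : PSL(2, F)) := by
  have : CharP F p := charP_of_injective_algebraMap (algebraMap (ZMod p) F).injective p
  have hodd : Odd p := (Fact.out : p.Prime).odd_of_ne_two hp
  have h2 : (2 : F) ≠ 0 := by
    intro h
    have : (p : ℕ) ∣ 2 := (CharP.cast_eq_zero_iff F p 2).1 (by exact_mod_cast h)
    exact hp ((Nat.prime_dvd_prime_iff_eq Fact.out Nat.prime_two).1 this)
  have lift : ∀ u : SL(2, F), u ^ p = 1 → ∃ v : SL(2, F), v ^ p = 1 ∧ φ u = (v : PSL(2, F)) := by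
    intro u hu
    obtain ⟨v, hv⟩ := QuotientGroup.mk_surjective (φ u)
    have : ((v ^ p : SL(2, F)) : PSL(2, F)) = 1 := by
      rw [QuotientGroup.mk_pow, hv, ← map_pow, ← QuotientGroup.mk_pow, hu, QuotientGroup.mk_one,
        map_one]
    obtain h | h := mk_eq_one_iff.1 this
    · exact ⟨v, h, hv.symm⟩
    · exact ⟨-v, by rw [hodd.neg_pow, h, neg_neg], by rw [mk_neg, hv]⟩
  obtain ⟨u, hu, hφu⟩ := lift (upper 1) (by rw [upper_pow]; simp [upper_zero])
  obtain ⟨v, hv, hφv⟩ := lift (lower 1) (by rw [lower_pow]; simp [lower_zero])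
  obtain ⟨hu₀, hu₁⟩ := trace_det_sub_one hu
  obtain ⟨hv₀, hv₁⟩ := trace_det_sub_one hv
  let w : SL(2, F) := upper 1 * (lower 1)⁻¹ * upper 1
  have hw : w.1 = !![0, 1; -1, 0] := by
    simp only [w, ← lower_neg]
    simp [coe_upper, coe_lower]
  have hw1 : (w : PSL(2, F)) ≠ 1 := by
    intro h
    obtain h | h := mk_eq_one_iff.1 h <;>
    · have := congrArg (fun g : SL(2, F) => g 0 1) h
      simp [hw] at this
  have hφw : φ (w : PSL(2, F)) = ((u * v⁻¹ * u : SL(2, F)) : PSL(2, F)) := by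
    simp only [w, QuotientGroup.mk_mul, QuotientGroup.mk_inv, map_mul, map_inv, hφu, hφv]
  have htr : (u * v⁻¹ * u).1.trace = 0 := by
    rw [← mk_sq_eq_one_iff (by rw [← hφw]; simpa using hw1), ← hφw, ← map_pow]
    rw [(mk_sq_eq_one_iff hw1).2 (by simp [hw, trace_fin_two]), map_one]
  have hNN : ((u.1 - 1) * (v.1 - 1)).trace = 1 := by
    rw [Matrix.SpecialLinearGroup.coe_mul, Matrix.SpecialLinearGroup.coe_mul,
      Matrix.SpecialLinearGroup.coe_inv] at htr
    generalize u.1 = U at *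
    generalize v.1 = V at *
    simp [trace_fin_two, det_fin_two, adjugate_fin_two, mul_apply, Fin.sum_univ_two] at *
    apply mul_left_cancel₀ h2
    clear hφw hφu hφv
    grind
  obtain ⟨M, hM₁, hM₂⟩ := exists_conj_eq hu₀ hu₁ hv₀ hv₁ hNN one_ne_zero
  refine ⟨M, fun g => ?_⟩
  let σ := Matrix.SpecialLinearGroup.map (n := Fin 2) (algebraMap (ZMod p) F)
  let ψ₁ : SL(2, ZMod p) →* PSL(2, F) :=
    φ.toMonoidHom.comp ((QuotientGroup.mk' _).comp σ)
  let ψ₂ : SL(2, ZMod p) →* PSL(2, F) := (QuotientGroup.mk' _).comp ((conj M).comp σ)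
  have hσu : σ (upper 1) = upper 1 := by
    ext i j; fin_cases i <;> fin_cases j <;> simp [σ, coe_upper]
  have hσl : σ (lower 1) = lower 1 := by
    ext i j; fin_cases i <;> fin_cases j <;> simp [σ, coe_lower]
  have : ψ₁.eqLocus ψ₂ = ⊤ := by
    refine eq_top_of_upper_one (μ := 1) ?_ one_ne_zero ?_
    · change φ (σ (upper 1) : SL(2, F)) = (conj M (σ (upper 1)) : PSL(2, F))
      rw [hσu, hφu, ← eq_conj_upper hM₁]
    · change φ (σ (lower 1) : SL(2, F)) = (conj M (σ (lower 1)) : PSL(2, F))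
      rw [hσl, hφv, ← eq_conj_lower hM₂]
  exact (this ▸ Subgroup.mem_top g : g ∈ ψ₁.eqLocus ψ₂)

end Automorphisms

section Parameters

variable {F : Type*} [Field F] {p : ℕ} [Fact p.Prime] [Algebra (ZMod p) F]
  {t x t' x' : F} {A' B' C' : SL(2, F)} {f f' : Tet →* PSL(2, F)}

lemma IsLift.apply_zero {A B C : SL(2, F)} (h : IsLift f A B C) :
    f (PresentedGroup.of 0) = (A : PSL(2, F)) := (isLift_iff.1 h).1

lemma IsLift.apply_one {A B C : SL(2, F)} (h : IsLift f A B C) :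
    f (PresentedGroup.of 1) = (B : PSL(2, F)) := (isLift_iff.1 h).2.1

lemma IsLift.apply_two {A B C : SL(2, F)} (h : IsLift f A B C) :
    f (PresentedGroup.of 2) = (C : PSL(2, F)) := (isLift_iff.1 h).2.2

lemma exists_mulEquiv_of_ker_eq {G H : Type*} [Group G] [Group H] {f f' : G →* H}
    (hf : Function.Surjective f) (hf' : Function.Surjective f') (h : f.ker = f'.ker) :
    ∃ φ : H ≃* H, ∀ g, φ (f g) = f' g := by
  let e₁ := QuotientGroup.quotientKerEquivOfSurjective f hf
  let e₂ := QuotientGroup.quotientKerEquivOfSurjective f' hf'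
  refine ⟨(e₁.symm.trans (QuotientGroup.quotientMulEquivOfEq h)).trans e₂, fun g => ?_⟩
  have : e₁.symm (f g) = (g : G ⧸ f.ker) := by
    rw [MulEquiv.symm_apply_eq]
    rfl
  simp only [MulEquiv.trans_apply, this]
  rfl

lemma trace_eq_or_of_mk_conj {M : GL (Fin 2) F} {g h : SL(2, F)}
    (e : (conj M g : PSL(2, F)) = h) : h.1.trace = g.1.trace ∨ h.1.trace = -g.1.trace := by
  obtain e | e := mk_eq_mk_iff.1 e
  · left
    rw [← e, trace_conj]
  · right
    rw [← trace_conj M g, e, trace_neg_coe, neg_neg]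

/-- Epimorphisms with the same kernel have the same parameter `t`. -/
lemma TetTriple.right_eq_of_ker_eq (hp : p ≠ 2) (h2 : (2 : F) ≠ 0) {A B : SL(2, ZMod p)}
    {C : SL(2, F)} (h : TetTriple t x (A.map (algebraMap (ZMod p) F)).1
      (B.map (algebraMap (ZMod p) F)).1 C.1)
    (hf : IsLift f (A.map (algebraMap (ZMod p) F)) (B.map (algebraMap (ZMod p) F)) C)
    (h' : TetTriple t' x' A'.1 B'.1 C'.1) (hf' : IsLift f' A' B' C')
    (hs : Function.Surjective f) (hs' : Function.Surjective f') (hk : f.ker = f'.ker) :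
    t = t' := by
  obtain ⟨φ, hφ⟩ := exists_mulEquiv_of_ker_eq hs hs' hk
  obtain ⟨M, hM⟩ := exists_conj_of_mulEquiv hp φ
  have hB := hφ (PresentedGroup.of 1)
  rw [hf.apply_one, hf'.apply_one, hM] at hB
  have := trace_eq_or_of_mk_conj hB
  rw [h.trace_right, h'.trace_right] at this
  have e := h.sq
  have e' := h'.sq
  obtain rfl | rfl := this
  · rfl
  · have : 2 * t = 0 := by linear_combination e' - e
    have : t = 0 := by simpa [h2] using this
    simp [this]

/-- Over the prime field, epimorphisms with the same kernel have the same parameter `x`. -/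
lemma TetTriple.left_third_eq_of_ker_eq (hp : p ≠ 2) (h2 : (2 : ZMod p) ≠ 0)
    {t x t' x' : ZMod p} {A B C A' B' C' : SL(2, ZMod p)} {f f' : Tet →* PSL(2, ZMod p)}
    (h : TetTriple t x A.1 B.1 C.1) (hf : IsLift f A B C)
    (h' : TetTriple t' x' A'.1 B'.1 C'.1) (hf' : IsLift f' A' B' C')
    (hs : Function.Surjective f) (hs' : Function.Surjective f') (hk : f.ker = f'.ker) :
    x = x' := by
  obtain ⟨φ, hφ⟩ := exists_mulEquiv_of_ker_eq hs hs' hk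
  obtain ⟨M, hM⟩ := exists_conj_of_mulEquiv hp φ
  have hid : ∀ g : SL(2, ZMod p), g.map (algebraMap (ZMod p) (ZMod p)) = g := fun g => by
    ext i j; simp
  simp only [hid] at hM
  have key : ∀ {g h : SL(2, ZMod p)}, g.1.trace = 1 → h.1.trace = 1 →
      (conj M g : PSL(2, ZMod p)) = h → conj M g = h := by
    intro g h hg hh e
    obtain e | e := mk_eq_mk_iff.1 e
    · exact e
    · have := trace_conj M g
      rw [e, trace_neg_coe, hg, hh] at this
      exact absurd (by linear_combination -this) h2
  have hA := hφ (PresentedGroup.of 0)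
  have hC := hφ (PresentedGroup.of 2)
  rw [hf.apply_zero, hf'.apply_zero, hM] at hA
  rw [hf.apply_two, hf'.apply_two, hM] at hC
  have hA' := key h.trace_left h'.trace_left hA
  have hC' := key h.trace_third h'.trace_third hC
  rw [← h.trace_left_third, ← h'.trace_left_third, ← hA', ← hC',
    ← Matrix.SpecialLinearGroup.coe_mul, ← Matrix.SpecialLinearGroup.coe_mul, ← map_mul, trace_conj]

end Parameters

section Unipotent

variable {F : Type*} [Field F]

lemma entries_mem {S : Subfield F} (h2 : (2 : F) ≠ 0) {a b c d : F} (hd : a * d - b * c = 1)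
    (ht : a + d ∈ S) (ht0 : a + d ≠ 0) (ha : a ^ 2 ∈ S) (hb : b ^ 2 ∈ S) (hc : c ^ 2 ∈ S)
    (hdd : d ^ 2 ∈ S) (hab : (a + b) ^ 2 ∈ S) (hac : (a + c) ^ 2 ∈ S) (hbd : (b + d) ^ 2 ∈ S)
    (hcd : (c + d) ^ 2 ∈ S) (h : (a + b + c + d) ^ 2 ∈ S) : a ∈ S ∧ b ∈ S ∧ c ∈ S ∧ d ∈ S := by
  have h2S : (2 : F) ∈ S := ofNat_mem S 2
  have pair : ∀ {y z : F}, y ^ 2 ∈ S → z ^ 2 ∈ S → (y + z) ^ 2 ∈ S → y * z ∈ S := by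
    intro y z hy hz hyz
    have : y * z = ((y + z) ^ 2 - y ^ 2 - z ^ 2) / 2 := by field_simp; ring
    rw [this]
    exact S.div_mem (S.sub_mem (S.sub_mem hyz hy) hz) h2S
  have cancel : ∀ {y : F}, y * a ∈ S → y * d ∈ S → y ∈ S := by
    intro y hya hyd
    have : y = (y * a + y * d) / (a + d) := by field_simp
    rw [this]
    exact S.div_mem (S.add_mem hya hyd) ht
  have pab := pair ha hb hab
  have pac := pair ha hc hac
  have pbd := pair hb hdd hbd
  have pcd := pair hc hdd hcd
  have pad : a * d ∈ S := by
    have : a * d = (((a + b + c + d) ^ 2 - a ^ 2 - b ^ 2 - c ^ 2 - d ^ 2) / 2 -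
        a * b - a * c - b * d - c * d + 1) / 2 := by
      field_simp
      linear_combination 2 * hd
    rw [this]
    refine S.div_mem (S.add_mem ?_ S.one_mem) h2S
    refine S.sub_mem (S.sub_mem (S.sub_mem (S.sub_mem (S.div_mem ?_ h2S) pab) pac) pbd) pcd
    exact S.sub_mem (S.sub_mem (S.sub_mem (S.sub_mem h ha) hb) hc) hdd
  refine ⟨cancel (by rwa [← sq]) pad, cancel (by rwa [mul_comm]) pbd,
    cancel (by rwa [mul_comm]) pcd, cancel (by rwa [mul_comm]) (by rwa [← sq])⟩

variable {p : ℕ} [Fact p.Prime] [Algebra (ZMod p) F] {H : Subgroup SL(2, F)}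

lemma exists_conj_of_unipotent {U g : SL(2, F)} (hU : U ∈ H) (hUp : U ^ p = 1) (hg : g ∈ H)
    (htr : (g.1 * (U.1 - 1)).trace ≠ 0) :
    ∃ M : GL (Fin 2) F, U = conj M (upper 1) ∧ upper 1 ∈ H.comap (conj M) ∧
      lower (-(g.1 * (U.1 - 1)).trace ^ 2) ∈ H.comap (conj M) := by
  have : CharP F p := charP_of_injective_algebraMap (algebraMap (ZMod p) F).injective p
  obtain ⟨h₀, h₁⟩ := trace_det_sub_one hUp
  have hUp' : (g * U * g⁻¹) ^ p = 1 := by rw [conj_pow, hUp, mul_one, mul_inv_cancel]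
  obtain ⟨h₀', h₁'⟩ := trace_det_sub_one hUp'
  have hμ : ((U.1 - 1) * ((g * U * g⁻¹).1 - 1)).trace = -(g.1 * (U.1 - 1)).trace ^ 2 := by
    have e : (g * U * g⁻¹).1 - 1 = g.1 * (U.1 - 1) * g⁻¹.1 := by
      rw [mul_sub, sub_mul, mul_one, ← Matrix.SpecialLinearGroup.coe_mul,
        ← Matrix.SpecialLinearGroup.coe_mul, ← Matrix.SpecialLinearGroup.coe_mul, mul_inv_cancel,
        Matrix.SpecialLinearGroup.coe_one]
    rw [e, Matrix.SpecialLinearGroup.coe_inv]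
    generalize U.1 - 1 = N at h₀ h₁
    generalize g.1 = G
    simp [trace_fin_two, det_fin_two, adjugate_fin_two, mul_apply, Fin.sum_univ_two] at *
    clear hUp' e htr
    grind
  obtain ⟨M, hM₁, hM₂⟩ := exists_conj_eq h₀ h₁ h₀' h₁' hμ (by simpa using htr)
  refine ⟨M, eq_conj_upper hM₁, ?_, ?_⟩
  · rw [Subgroup.mem_comap, ← eq_conj_upper hM₁]
    exact hU
  · rw [Subgroup.mem_comap, ← eq_conj_lower hM₂]
    exact mul_mem (mul_mem hg hU) (inv_mem hg)

lemma TetPair.exists_trace_ne_zero {t : F} {A B : SL(2, F)} (h : TetPair t A.1 B.1)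
    (h2 : (2 : F) ≠ 0) (h3 : (3 : F) ≠ 0) (hA : A ∈ H) (hB : B ∈ H) {U : SL(2, F)}
    (hUp : U ^ p = 1) (hU1 : U ≠ 1) : ∃ g ∈ H, (g.1 * (U.1 - 1)).trace ≠ 0 := by
  have : CharP F p := charP_of_injective_algebraMap (algebraMap (ZMod p) F).injective p
  obtain ⟨h₀, h₁⟩ := trace_det_sub_one hUp
  by_contra! hH
  have := h.nilpotent_eq_zero h2 h3 (N := U.1 - 1) (by rw [mul_self_eq, h₀, h₁]; simp) h₀
    (hH A hA) (hH B hB)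
  exact hU1 (Subtype.ext (sub_eq_zero.1 this))

lemma TetPair.eq_top_of_unipotent {t : ZMod p} {A B : SL(2, ZMod p)} {H : Subgroup SL(2, ZMod p)}
    (h : TetPair t A.1 B.1) (h2 : (2 : ZMod p) ≠ 0) (h3 : (3 : ZMod p) ≠ 0) (hA : A ∈ H)
    (hB : B ∈ H) {U : SL(2, ZMod p)} (hU : U ∈ H) (hUp : U ^ p = 1) (hU1 : U ≠ 1) : H = ⊤ := by
  obtain ⟨g, hg, htr⟩ := h.exists_trace_ne_zero h2 h3 hA hB hUp hU1
  obtain ⟨M, -, hu, hl⟩ := exists_conj_of_unipotent hU hUp hg htr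
  exact eq_top_of_comap_conj M (eq_top_of_upper_one hu (by simpa using htr) hl)

lemma TetTriple.eq_top_of_unipotent (hF : Module.finrank (ZMod p) F = 2) {t x : F}
    {A B C : SL(2, F)} (h : TetTriple t x A.1 B.1 C.1)
    (hx : ∀ k : ZMod p, algebraMap _ F k ≠ x)
    (h2 : (2 : ZMod p) ≠ 0) (h3 : (3 : ZMod p) ≠ 0) (hA : A ∈ H) (hB : B ∈ H) (hC : C ∈ H)
    {U : SL(2, F)} (hU : U ∈ H) (hUp : U ^ p = 1) (hU1 : U ≠ 1) : H = ⊤ := by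
  have h2' : (2 : F) ≠ 0 := by
    rw [← map_ofNat (algebraMap (ZMod p) F) 2]
    exact (map_ne_zero _).2 h2
  have h3' : (3 : F) ≠ 0 := by
    rw [← map_ofNat (algebraMap (ZMod p) F) 3]
    exact (map_ne_zero _).2 h3
  obtain ⟨g, hg, htr⟩ := h.exists_trace_ne_zero h2' h3' hA hB hUp hU1
  let S : Subfield F := (algebraMap (ZMod p) F).fieldRange
  have hS : ∀ {y : F}, y ∈ S ↔ ∃ k : ZMod p, algebraMap _ F k = y := RingHom.mem_fieldRange
  by_cases hall : ∀ g ∈ H, (g.1 * (U.1 - 1)).trace ^ 2 ∈ S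
  swap
  · push Not at hall
    obtain ⟨g, hg, htr⟩ := hall
    have htr0 : (g.1 * (U.1 - 1)).trace ≠ 0 := by
      intro h0
      rw [h0] at htr
      exact htr (by simp)
    obtain ⟨M, -, hu, hl⟩ := exists_conj_of_unipotent hU hUp hg htr0
    refine eq_top_of_comap_conj M (eq_top_of_upper_one_of_finrank hF h2 h3 hu ?_ hl)
    intro k hk
    exact htr (hS.2 ⟨-k, by rw [map_neg, hk, neg_neg]⟩)
  exfalso
  obtain ⟨M, hUM, hu, hl⟩ := exists_conj_of_unipotent hU hUp hg htr
  obtain ⟨m, hm⟩ := hS.1 (hall g hg)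
  have hm0 : m ≠ 0 := by
    rintro rfl
    rw [map_zero] at hm
    exact htr (by simpa using hm.symm)
  set H' := H.comap (conj M) with hH'
  let σ := Matrix.SpecialLinearGroup.map (n := Fin 2) (algebraMap (ZMod p) F)
  have hσ : ∀ g, σ g ∈ H' := by
    have : H'.comap σ = ⊤ := by
      refine eq_top_of_upper_one (μ := -m) ?_ (by simpa using hm0) ?_
      · rw [Subgroup.mem_comap]
        convert hu using 1
        ext i j; fin_cases i <;> fin_cases j <;> simp [σ, coe_upper]
      · rw [Subgroup.mem_comap]
        convert hl using 1
        rw [← hm]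
        ext i j; fin_cases i <;> fin_cases j <;> simp [σ, coe_lower]
    intro g
    exact (this ▸ Subgroup.mem_top g : g ∈ H'.comap σ)
  have hsq : ∀ g ∈ H', (g 1 0) ^ 2 ∈ S := by
    intro g hg
    have := hall _ hg
    have e : ((conj M g).1 * (U.1 - 1)).trace = g 1 0 := by
      have hU' : U.1 - 1 = M.1 * !![0, 1; 0, 0] * M⁻¹.1 := by
        have hE : (!![0, 1; 0, 0] : Matrix (Fin 2) (Fin 2) F) = (upper (1 : F)).1 - 1 := by
          simp [coe_upper, one_fin_two]
        rw [hE, mul_sub, sub_mul, mul_one, Units.mul_inv, hUM, coe_conj]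
      have e' : M.1 * g.1 * M⁻¹.1 * (M.1 * !![0, 1; 0, 0] * M⁻¹.1) =
          M.1 * (g.1 * !![0, 1; 0, 0]) * M⁻¹.1 := by
        simp only [mul_assoc, Units.inv_mul_cancel_left]
      rw [coe_conj, hU', e', trace_units_conj]
      simp [trace_fin_two, mul_apply, Fin.sum_univ_two]
    rwa [e] at this
  have entries : ∀ g ∈ H', g.1.trace ∈ S → g.1.trace ≠ 0 → ∀ i j, g i j ∈ S := by
    intro g hg htS ht0
    obtain ⟨w, hw⟩ : ∃ w, (σ w).1 = !![0, -1; 1, 0] :=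
      ⟨⟨!![0, -1; 1, 0], by simp [det_fin_two]⟩, by
        change (algebraMap (ZMod p) F).mapMatrix !![0, -1; 1, 0] = _
        ext i j; fin_cases i <;> fin_cases j <;> simp⟩
    obtain ⟨l, hl⟩ : ∃ l, (σ l).1 = !![1, 0; 1, 1] :=
      ⟨lower 1, by ext i j; fin_cases i <;> fin_cases j <;> simp [σ, coe_lower]⟩
    obtain ⟨e, he⟩ : ∃ e, (σ e).1 = !![1, 0; 0, 1] := ⟨1, by simp [one_fin_two]⟩
    have key : ∀ g₁ g₂, ((σ g₁ * g * σ g₂ : SL(2, F)) 1 0) ^ 2 ∈ S := fun g₁ g₂ =>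
      hsq _ (mul_mem (mul_mem (hσ g₁) hg) (hσ g₂))
    have hd := g.det_coe
    rw [det_fin_two] at hd
    rw [trace_fin_two] at htS ht0
    obtain ⟨h00, h01, h10, h11⟩ := entries_mem h2' hd htS ht0
      (by simpa [hw, hl, he, mul_apply, vecMul, dotProduct, Fin.sum_univ_two] using key w e)
      (by simpa [hw, hl, he, mul_apply, vecMul, dotProduct, Fin.sum_univ_two] using key w w)
      (by simpa [hw, hl, he, mul_apply, vecMul, dotProduct, Fin.sum_univ_two] using key e e)
      (by simpa [hw, hl, he, mul_apply, vecMul, dotProduct, Fin.sum_univ_two] using key e w)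
      (by simpa [hw, hl, he, mul_apply, vecMul, dotProduct, Fin.sum_univ_two] using key w l)
      (by simpa [hw, hl, he, mul_apply, vecMul, dotProduct, Fin.sum_univ_two] using key l e)
      (by simpa [hw, hl, he, mul_apply, vecMul, dotProduct, Fin.sum_univ_two] using key l w)
      (by simpa [hw, hl, he, mul_apply, vecMul, dotProduct, Fin.sum_univ_two] using key e l)
      (by
        have := key l l
        simp [hl, mul_apply, vecMul, dotProduct, Fin.sum_univ_two] at this
        convert this using 2
        ring)
    intro i j
    fin_cases i <;> fin_cases j <;> assumption
  have hmem : ∀ {g}, g ∈ H → conj M⁻¹ g ∈ H' := by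
    intro g hg
    rwa [hH', Subgroup.mem_comap, conj_conj_inv]
  have eA := entries _ (hmem hA) (by rw [trace_conj, h.trace_left]; exact S.one_mem)
    (by rw [trace_conj, h.trace_left]; exact one_ne_zero)
  have eC := entries _ (hmem hC) (by rw [trace_conj, h.trace_third]; exact S.one_mem)
    (by rw [trace_conj, h.trace_third]; exact one_ne_zero)
  have hxS : x ∈ S := by
    rw [← h.trace_left_third, ← Matrix.SpecialLinearGroup.coe_mul, ← trace_conj M⁻¹, map_mul,
      Matrix.SpecialLinearGroup.coe_mul, trace_fin_two]
    simp only [mul_apply, Fin.sum_univ_two]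
    exact S.add_mem (S.add_mem (S.mul_mem (eA _ _) (eC _ _)) (S.mul_mem (eA _ _) (eC _ _)))
      (S.add_mem (S.mul_mem (eA _ _) (eC _ _)) (S.mul_mem (eA _ _) (eC _ _)))
  obtain ⟨k, hk⟩ := hS.1 hxS
  exact hx k hk

end Unipotent

section TwoFixedPoints

lemma eq_two_or_three_or_five_aux {n d₁ d₂ d₃ e₁ e₂ e₃ : ℕ} (h₁ : d₁ * e₁ = n)
    (h₂ : d₂ * e₂ = n) (h₃ : d₃ * e₃ = n) (hd : d₁ + d₂ + d₃ = n + 2) (hd₁ : 3 ≤ d₁)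
    (he₂ : 2 ≤ e₂) (he₃ : e₂ ≤ e₃) (h5 : 5 ∣ e₁) :
    e₁ = 5 ∧ e₂ = 2 ∧ e₃ = 3 := by
  have bound : ∀ {d e : ℕ} (m : ℕ), d * e = n → m ≤ e → d * m ≤ n := fun m hde hm =>
    hde ▸ Nat.mul_le_mul_left _ hm
  have he₁ : 5 ≤ e₁ := Nat.le_of_dvd (Nat.pos_of_ne_zero fun h => by subst h; lia) h5
  have b₁ := bound 5 h₁ he₁
  have e2 : e₂ = 2 := by
    by_contra hne
    have b₂ := bound 3 h₂ (by lia)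
    have b₃ := bound 3 h₃ (by lia)
    lia
  subst e2
  have e3 : e₃ = 3 := by
    by_contra hne
    obtain rfl | h : e₃ = 2 ∨ 4 ≤ e₃ := by lia
    · lia
    · have b₃ := bound 4 h₃ h
      lia
  subst e3
  refine ⟨?_, rfl, rfl⟩
  by_contra hne
  have := bound 6 h₁ (by lia)
  lia

lemma eq_two_or_three_or_five {n d₁ d₂ d₃ e₁ e₂ e₃ : ℕ} (h₁ : d₁ * e₁ = n)
    (h₂ : d₂ * e₂ = n) (h₃ : d₃ * e₃ = n) (hd : d₁ + d₂ + d₃ = n + 2) (hd₁ : 3 ≤ d₁)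
    (he₂ : 2 ≤ e₂) (he₃ : 2 ≤ e₃) (h5 : 5 ∣ e₁) :
    e₁ = 5 ∧ (e₂ = 2 ∧ e₃ = 3 ∨ e₂ = 3 ∧ e₃ = 2) := by
  obtain h | h := le_total e₂ e₃
  · have := eq_two_or_three_or_five_aux h₁ h₂ h₃ hd hd₁ he₂ h h5
    lia
  · have := eq_two_or_three_or_five_aux h₁ h₃ h₂ (by lia) hd₁ he₃ h h5
    lia

open MulAction

variable {G X : Type*} [Group G] [Finite G] [MulAction G X]

lemma card_fixedPoints_formula [Finite X] (h2 : ∀ g : G, g ≠ 1 → Nat.card (fixedBy X g) = 2) :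
    2 * (Nat.card G - 1) + Nat.card X = Nat.card (Quotient (orbitRel G X)) * Nat.card G := by
  classical
  have := Fintype.ofFinite G
  have := Fintype.ofFinite X
  have := Fintype.ofFinite (Quotient (orbitRel G X))
  have e := sum_card_fixedBy_eq_card_orbits_mul_card_group G X
  simp only [Nat.card_eq_fintype_card] at h2 ⊢
  rw [← e, ← Finset.add_sum_erase _ _ (Finset.mem_univ (1 : G)),
    Finset.sum_congr rfl fun g hg => h2 g (Finset.ne_of_mem_erase hg), Finset.sum_const,
    Finset.card_erase_of_mem (Finset.mem_univ _), Finset.card_univ, smul_eq_mul, mul_comm, add_comm]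
  congr 1
  rw [Fintype.card_congr ((Equiv.setCongr (fixedBy_one_eq_univ X G)).trans (Equiv.Set.univ X))]

lemma card_eq_sum_index [Fintype (Quotient (orbitRel G X))] :
    Nat.card X = ∑ ω : Quotient (orbitRel G X), (stabilizer G ω.out).index := by
  rw [Nat.card_congr (selfEquivSigmaOrbitsQuotientStabilizer G X), Nat.card_sigma]
  rfl

/-- A finite group in which every nontrivial element has exactly two fixed points, containing
an element of order `5`, is icosahedral unless it is cyclic or dihedral. -/
lemma pow_eq_one_of_card_fixedBy [Finite X] (h2 : ∀ g : G, g ≠ 1 → Nat.card (fixedBy X g) = 2)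
    (hbot : ∀ x : X, stabilizer G x ≠ ⊥) (htop : ∀ x : X, stabilizer G x ≠ ⊤)
    (hsq : ∀ S : Subgroup G, (∀ g, g ^ 2 ∈ S) → S = ⊤) {b : G} (hb : orderOf b = 5) (g : G) :
    g ^ 2 = 1 ∨ g ^ 3 = 1 ∨ g ^ 5 = 1 := by
  classical
  have := Fintype.ofFinite (Quotient (orbitRel G X))
  have key : ∀ a : G, a ≠ 1 → ∃ ω : Quotient (orbitRel G X),
      orderOf a ∣ Nat.card (stabilizer G ω.out) := by
    intro a ha
    have : (fixedBy X a).Nonempty := by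
      rw [Set.nonempty_iff_ne_empty]
      intro h
      have := h2 a ha
      simp [h] at this
    obtain ⟨x, hx⟩ := this
    refine ⟨Quotient.mk'' x, ?_⟩
    have hr : orbitRel G X (Quotient.mk'' x : Quotient (orbitRel G X)).out x :=
      Quotient.exact (Quotient.out_eq' _)
    rw [Nat.card_congr (stabilizerEquivStabilizerOfOrbitRel hr).toEquiv]
    exact Subgroup.orderOf_dvd_natCard _ hx
  set n := Nat.card G with hn
  set e : Quotient (orbitRel G X) → ℕ := fun ω => Nat.card (stabilizer G ω.out) with he
  set d : Quotient (orbitRel G X) → ℕ := fun ω => (stabilizer G ω.out).index with hd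
  have hde : ∀ ω, d ω * e ω = n := fun ω => Subgroup.index_mul_card _
  have he2 : ∀ ω, 2 ≤ e ω := fun ω => (Subgroup.one_lt_card_iff_ne_bot _).2 (hbot _)
  have hd0 : ∀ ω, d ω ≠ 0 := fun ω => Subgroup.index_ne_zero_of_finite
  have hd1 : ∀ ω, d ω ≠ 1 := fun ω h => htop _ (Subgroup.index_eq_one.1 h)
  have hd2 : ∀ ω, d ω ≠ 2 := fun ω h => htop _ (hsq _ (Subgroup.sq_mem_of_index_two h))
  have hd3 : ∀ ω, 3 ≤ d ω := fun ω => by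
    have := hd0 ω; have := hd1 ω; have := hd2 ω; lia
  have hb1 : b ≠ 1 := by rintro rfl; simp at hb
  have hn2 : 2 ≤ n := by
    obtain ⟨ω, -⟩ := key b hb1
    have h1 := hde ω; have h2 := he2 ω; have h3 := hd3 ω
    nlinarith
  have hsum := card_fixedPoints_formula h2
  rw [card_eq_sum_index (G := G) (X := X)] at hsum
  change 2 * (n - 1) + ∑ ω, d ω = _ * n at hsum
  have hle : 2 * ∑ ω, d ω ≤ Nat.card (Quotient (orbitRel G X)) * n := by
    rw [Finset.mul_sum, Nat.card_eq_fintype_card, ← smul_eq_mul, ← Finset.card_univ]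
    exact Finset.sum_le_card_nsmul _ _ _ fun ω _ => by
      rw [← hde ω, mul_comm]; exact Nat.mul_le_mul_left _ (he2 ω)
  have hge : 3 * Nat.card (Quotient (orbitRel G X)) ≤ ∑ ω, d ω := by
    rw [mul_comm, Nat.card_eq_fintype_card, ← smul_eq_mul, ← Finset.card_univ]
    exact Finset.card_nsmul_le_sum _ _ _ fun ω _ => hd3 ω
  have hcard : Nat.card (Quotient (orbitRel G X)) = 3 := by
    generalize Nat.card (Quotient (orbitRel G X)) = r at hsum hle hge
    generalize ∑ ω, d ω = D at hsum hle hge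
    have : r < 4 := by
      by_contra! h
      have := Nat.mul_le_mul_right n h
      lia
    interval_cases r <;> lia
  rw [hcard] at hsum
  rw [Nat.card_eq_fintype_card, ← Finset.card_univ, Finset.card_eq_three] at hcard
  obtain ⟨ω₁, ω₂, ω₃, h₁₂, h₁₃, h₂₃, huniv⟩ := hcard
  rw [huniv, Finset.sum_insert (by simp [h₁₂, h₁₃]), Finset.sum_pair h₂₃] at hsum
  have hmem : ∀ ω, ω = ω₁ ∨ ω = ω₂ ∨ ω = ω₃ := fun ω => by
    simpa [huniv] using Finset.mem_univ ω
  have hall : ∀ ω, e ω = 2 ∨ e ω = 3 ∨ e ω = 5 := by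
    obtain ⟨ω, hω⟩ := key b hb1
    rw [hb] at hω
    change 5 ∣ e ω at hω
    obtain rfl | rfl | rfl := hmem ω
    · have := eq_two_or_three_or_five (hde ω) (hde ω₂) (hde ω₃) (by lia) (hd3 _) (he2 _) (he2 _) hω
      intro ω'
      obtain rfl | rfl | rfl := hmem ω' <;> lia
    · have := eq_two_or_three_or_five (hde ω) (hde ω₁) (hde ω₃) (by lia) (hd3 _) (he2 _) (he2 _) hω
      intro ω'
      obtain rfl | rfl | rfl := hmem ω' <;> lia
    · have := eq_two_or_three_or_five (hde ω) (hde ω₁) (hde ω₂) (by lia) (hd3 _) (he2 _) (he2 _) hω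
      intro ω'
      obtain rfl | rfl | rfl := hmem ω' <;> lia
  by_cases hg : g = 1
  · simp [hg]
  obtain ⟨ω, hω⟩ := key g hg
  change _ ∣ e ω at hω
  obtain h | h | h := hall ω <;> rw [h] at hω <;> simp [orderOf_dvd_iff_pow_eq_one.1 hω]

end TwoFixedPoints

section ProjectiveLine

open MulAction

lemma pow_eq_one_of_ncard_fixedBy {G Y : Type*} [Group G] [Finite G] [MulAction G Y]
    (h2 : ∀ g : G, g ≠ 1 → (fixedBy Y g).ncard = 2) (htop : ∀ y : Y, stabilizer G y ≠ ⊤)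
    (hsq : ∀ S : Subgroup G, (∀ g, g ^ 2 ∈ S) → S = ⊤) {b : G} (hb : orderOf b = 5) (g : G) :
    g ^ 2 = 1 ∨ g ^ 3 = 1 ∨ g ^ 5 = 1 := by
  let X : SubMulAction G Y :=
    { carrier := {y | ∃ g : G, g ≠ 1 ∧ g • y = y}
      smul_mem' := by
        rintro c y ⟨g, hg, hy⟩
        exact ⟨c * g * c⁻¹, by simpa using hg, by simp [mul_smul, hy]⟩ }
  have : Finite X := by
    have : (⋃ g : {g : G // g ≠ 1}, fixedBy Y g.1).Finite :=
      Set.finite_iUnion fun g => Set.finite_of_ncard_ne_zero (by rw [h2 g.1 g.2]; norm_num)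
    refine this.subset ?_
    rintro y ⟨g, hg, hy⟩
    exact Set.mem_iUnion.2 ⟨⟨g, hg⟩, hy⟩
  refine pow_eq_one_of_card_fixedBy (X := X) ?_ ?_ ?_ hsq hb g
  · intro g hg
    rw [Nat.card_coe_set_eq, ← Set.ncard_image_of_injective _ Subtype.val_injective, ← h2 g hg]
    congr 1
    ext y
    constructor
    · rintro ⟨x, hx, rfl⟩
      exact congrArg Subtype.val hx
    · intro hy
      exact ⟨⟨y, g, hg, hy⟩, Subtype.ext hy, rfl⟩
  · rintro ⟨y, g, hg, hy⟩ h
    have : g ∈ stabilizer G (⟨y, g, hg, hy⟩ : X) := Subtype.ext hy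
    rw [h, Subgroup.mem_bot] at this
    exact hg this
  · intro x h
    refine htop x.1 (eq_top_iff.2 fun g _ => ?_)
    have : g ∈ stabilizer G x := h ▸ Subgroup.mem_top g
    exact congrArg Subtype.val this

variable {K : Type*} [Field K] [DecidableEq K]

/-- The action of `SL(2, K)` on the projective line by Möbius transformations. -/
noncomputable def moebius : SL(2, K) →* Equiv.Perm (OnePoint K) :=
  (toPermHom (GL (Fin 2) K) (OnePoint K)).comp Matrix.SpecialLinearGroup.toGL

lemma moebius_infty (g : SL(2, K)) :
    moebius g OnePoint.infty = OnePoint.infty ↔ g 1 0 = 0 :=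
  OnePoint.smul_infty_eq_self_iff

lemma moebius_coe (g : SL(2, K)) (k : K) :
    moebius g k = k ↔ g 1 0 * k ^ 2 + (g 1 1 - g 0 0) * k - g 0 1 = 0 := by
  change Matrix.SpecialLinearGroup.toGL g • (k : OnePoint K) = k ↔ _
  rw [← Matrix.GeneralLinearGroup.fixpointPolynomial_aeval_eq_zero_iff]
  simp [Matrix.GeneralLinearGroup.fixpointPolynomial]

lemma moebius_neg_one : moebius (-1 : SL(2, K)) = 1 := by
  ext P : 1
  change moebius (-1) P = P
  cases P with
  | infty => simp [moebius_infty]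
  | coe k => simp [moebius_coe]

lemma moebius_eq_one {g : SL(2, K)} (h : moebius g = 1) : g = 1 ∨ g = -1 := by
  have hP : ∀ P, moebius g P = P := fun P => by rw [h]; rfl
  have h10 := (moebius_infty g).1 (hP _)
  have h01 := (moebius_coe g 0).1 (hP _)
  have h11 := (moebius_coe g 1).1 (hP _)
  have hd := g.det_coe
  rw [det_fin_two] at hd
  have h0 : g 0 1 = 0 := by simpa using h01
  have h1 : g 1 1 = g 0 0 := by grind
  have : g 0 0 * g 0 0 = 1 := by grind
  obtain h | h := mul_self_eq_one_iff.1 this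
  · left
    ext i j
    fin_cases i <;> fin_cases j <;> simp [*]
  · right
    ext i j
    fin_cases i <;> fin_cases j <;> simp [*]

lemma ncard_fixed_moebius [IsAlgClosed K] (h2 : (2 : K) ≠ 0) {g : SL(2, K)}
    (hg : g.1.trace ^ 2 ≠ 4) : {P | moebius g P = P}.ncard = 2 := by
  have hd := g.det_coe
  rw [det_fin_two] at hd
  rw [trace_fin_two] at hg
  by_cases hc : g 1 0 = 0
  · have hne : g 1 1 - g 0 0 ≠ 0 := by
      intro h
      apply hg
      have : g 1 1 = g 0 0 := sub_eq_zero.1 h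
      grind
    rw [show {P | moebius g P = P} = {OnePoint.infty, ((g 0 1 / (g 1 1 - g 0 0) : K) : OnePoint K)}
      by
        ext P
        cases P with
        | infty => simp [moebius_infty, hc]
        | coe k =>
          simp only [Set.mem_ofPred, moebius_coe, hc, zero_mul, zero_add, Set.mem_insert_iff,
            OnePoint.coe_ne_infty, false_or, Set.mem_singleton_iff, OnePoint.coe_eq_coe,
            eq_div_iff hne, sub_eq_zero]
          rw [mul_comm]]
    exact Set.ncard_pair (OnePoint.infty_ne_coe _)
  · obtain ⟨r, hr⟩ := IsAlgClosed.exists_pow_nat_eq ((g 0 0 + g 1 1) ^ 2 - 4) (n := 2) (by norm_num)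
    have hr0 : r ≠ 0 := by
      rintro rfl
      apply hg
      linear_combination -hr
    have hcc : 2 * g 1 0 ≠ 0 := mul_ne_zero h2 hc
    rw [show {P | moebius g P = P} = {(((g 0 0 - g 1 1 + r) / (2 * g 1 0) : K) : OnePoint K),
      (((g 0 0 - g 1 1 - r) / (2 * g 1 0) : K) : OnePoint K)} by
        ext P
        cases P with
        | infty => simp [moebius_infty, hc]
        | coe k =>
          simp only [Set.mem_ofPred, moebius_coe, Set.mem_insert_iff, Set.mem_singleton_iff,
            OnePoint.coe_eq_coe, eq_div_iff hcc]
          have e : (2 * g 1 0) * 2 * (g 1 0 * k ^ 2 + (g 1 1 - g 0 0) * k - g 0 1) =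
              (k * (2 * g 1 0) - (g 0 0 - g 1 1 + r)) *
              (k * (2 * g 1 0) - (g 0 0 - g 1 1 - r)) := by
            linear_combination hr + 4 * hd
          rw [← sub_eq_zero (b := g 0 0 - g 1 1 + r), ← sub_eq_zero (b := g 0 0 - g 1 1 - r),
            ← mul_eq_zero, ← e]
          simp [h2, hc]]
    refine Set.ncard_pair fun h => hr0 ?_
    rw [OnePoint.coe_eq_coe, div_left_inj' hcc] at h
    have : 2 * r = 0 := by linear_combination h
    simpa [h2] using this

lemma TetPair.not_fixed {t : K} {A B : SL(2, K)} (h : TetPair t A.1 B.1) (h2 : (2 : K) ≠ 0)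
    (h3 : (3 : K) ≠ 0) (P : OnePoint K) : ¬ (moebius A P = P ∧ moebius B P = P) := by
  rintro ⟨hA, hB⟩
  cases P with
  | infty =>
    rw [moebius_infty] at hA hB
    have := h.nilpotent_eq_zero h2 h3 (N := !![0, 1; 0, 0])
      (by ext i j; fin_cases i <;> fin_cases j <;> simp) (by simp [trace_fin_two])
      (by simpa [trace_fin_two, mul_apply, Fin.sum_univ_two] using hA)
      (by simpa [trace_fin_two, mul_apply, Fin.sum_univ_two] using hB)
    simpa using congrFun (congrFun this 0) 1
  | coe k =>
    rw [moebius_coe] at hA hB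
    have := h.nilpotent_eq_zero h2 h3 (N := !![k, -k ^ 2; 1, -k])
      (by ext i j; fin_cases i <;> fin_cases j <;> simp [mul_apply, Fin.sum_univ_two] <;> ring)
      (by simp [trace_fin_two])
      (by simp [trace_fin_two, mul_apply, Fin.sum_univ_two]; linear_combination -hA)
      (by simp [trace_fin_two, mul_apply, Fin.sum_univ_two]; linear_combination -hB)
    simpa using congrFun (congrFun this 1) 0

variable {p : ℕ} [Fact p.Prime]

lemma pow_eq_one_of_trace_eq_two {F : Type*} [Field F] [CharP F p] {g : SL(2, F)}
    (hg : g.1.trace = 2) : g ^ p = 1 := by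
  have h : (g.1 - 1) ^ 2 = 0 := by
    rw [sq, sub_mul, mul_sub, coe_mul_self, hg]
    simp only [mul_one, one_mul]
    module
  have hp : (g.1 - 1) ^ p = 0 := pow_eq_zero_of_le (Fact.out : p.Prime).two_le h
  rw [sub_pow_char_of_commute p (Commute.one_right g.1), one_pow, sub_eq_zero] at hp
  exact Subtype.ext (by simpa using hp)

lemma TetPair.left_pow_three {F : Type*} [Field F] {t : F} {A B : SL(2, F)}
    (h : TetPair t A.1 B.1) : A ^ 3 = -1 := by
  have e := coe_mul_self A
  rw [h.trace_left, one_smul] at e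
  have key : ∀ M : Matrix (Fin 2) (Fin 2) F, M * M = M - 1 → M ^ 3 = -1 := fun M hM => by
    rw [pow_succ, pow_two, hM, sub_mul, hM]
    simp
  exact Subtype.ext ((Matrix.SpecialLinearGroup.coe_pow A 3).trans ((key _ e).trans (by simp)))

lemma TetTriple.trace_left_third_ne {F : Type*} [Field F] {t x : F} {A B C : SL(2, F)}
    (h : TetTriple t x A.1 B.1 C.1) (h2 : (2 : F) ≠ 0) (h3 : (3 : F) ≠ 0) (h29 : (29 : F) ≠ 0) :
    ((A * C : SL(2, F)) : PSL(2, F)) ^ 2 ≠ 1 ∧ ((A * C : SL(2, F)) : PSL(2, F)) ^ 3 ≠ 1 ∧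
      ((A * C : SL(2, F)) : PSL(2, F)) ^ 5 ≠ 1 := by
  have hx := h.eq_zero h2
  have ht := h.sq
  have htr : (A * C : SL(2, F)).1.trace = x := by simpa using h.trace_left_third
  have ht0 : t ≠ 0 := by rintro rfl; simp at ht
  have ht1 : t ≠ 1 := by rintro rfl; exact one_ne_zero (by linear_combination -ht)
  have ht2 : t ≠ -1 := by rintro rfl; norm_num at ht
  have hne : ((A * C : SL(2, F)) : PSL(2, F)) ≠ 1 := by
    rw [Ne, mk_eq_one_iff]
    rintro (e | e) <;> rw [e] at htr
    · have : x = 2 := by rw [← htr]; simp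
      subst this
      exact ht2 (by linear_combination hx)
    · have : x = -2 := by rw [← htr]; simp
      subst this
      exact h29 (by linear_combination ht - (t - 6) * hx)
  refine ⟨?_, ?_, ?_⟩
  · rw [Ne, mk_sq_eq_one_iff hne, htr]
    rintro rfl
    exact ht1 (by linear_combination hx)
  · rw [Ne, mk_pow_three_eq_one_iff hne, htr, sub_eq_zero, sq_eq_one_iff]
    rintro (rfl | rfl)
    · exact ht1 (by linear_combination hx)
    · exact ht2 (by linear_combination hx)
  · rw [Ne, mk_pow_five_eq_one_iff hne, htr]
    intro e
    have : (x ^ 2 - (x + 1)) * (x ^ 2 - (-x + 1)) = 0 := by rw [← e]; ring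
    obtain e | e := mul_eq_zero.1 this
    · exact ht0 (by linear_combination hx - e)
    · have e1 : t = 2 * x := by linear_combination hx - e
      have : 3 * (2 * x - 1) = 0 := by subst e1; linear_combination 4 * e - ht
      have := (mul_eq_zero.1 this).resolve_left h3
      exact ht1 (by linear_combination e1 + this)

lemma TetTriple.exists_unipotent_of_isAlgClosed [IsAlgClosed K] [CharP K p] {t x : K}
    {A B C : SL(2, K)} (h : TetTriple t x A.1 B.1 C.1) (h2 : (2 : K) ≠ 0) (h3 : (3 : K) ≠ 0)
    (h5 : (5 : K) ≠ 0) (h29 : (29 : K) ≠ 0) [Finite (word A B C).range] :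
    ∃ w, word A B C w ^ p = 1 ∧ word A B C w ≠ 1 := by
  by_contra! hw
  let φ : FreeGroup (Fin 3) →* Equiv.Perm (OnePoint K) := moebius.comp (word A B C)
  have hφ : ∀ w, φ w = moebius (word A B C w) := fun _ => rfl
  have hfin : Finite φ.range := by
    rw [MonoidHom.range_comp]
    exact Finite.of_surjective _ ((moebius (K := K)).subgroupMap_surjective (word A B C).range)
  have hmk : ∀ w (n : ℕ), φ.rangeRestrict w ^ n = 1 → (word A B C w : PSL(2, K)) ^ n = 1 := by
    intro w n hn
    rw [← map_pow, Subtype.ext_iff] at hn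
    rw [← QuotientGroup.mk_pow, mk_eq_one_iff, ← map_pow]
    exact moebius_eq_one hn
  have hmk' : ∀ w (n : ℕ), (word A B C w : PSL(2, K)) ^ n = 1 → φ.rangeRestrict w ^ n = 1 := by
    intro w n hn
    rw [← QuotientGroup.mk_pow, mk_eq_one_iff, ← map_pow] at hn
    rw [← map_pow]
    apply Subtype.ext
    change moebius (word A B C (w ^ n)) = 1
    obtain hn | hn := hn <;> rw [hn]
    · exact map_one _
    · exact moebius_neg_one
  obtain ⟨f, hf⟩ := h.exists_isLift
  have hrel : ∀ r ∈ tetRelators, (word A B C r : PSL(2, K)) = 1 := fun r hr => by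
    rw [← hf, PresentedGroup.one_of_mem hr, map_one]
  have hα : φ.rangeRestrict (FreeGroup.of 0) ^ 3 = 1 := hmk' _ _ (by
    rw [← QuotientGroup.mk_pow, ← map_pow]
    exact hrel _ (by simp [tetRelators]))
  have hβ : φ.rangeRestrict (FreeGroup.of 1) ^ 5 = 1 := hmk' _ _ (by
    rw [← QuotientGroup.mk_pow, ← map_pow]
    exact hrel _ (by simp [tetRelators]))
  have hγ : φ.rangeRestrict (FreeGroup.of 2) ^ 3 = 1 := hmk' _ _ (by
    rw [← QuotientGroup.mk_pow, ← map_pow]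
    exact hrel _ (by simp [tetRelators]))
  have hβ1 : φ.rangeRestrict (FreeGroup.of 1) ≠ 1 := by
    intro e
    have := hmk _ 1 (by rw [e, one_pow])
    rw [pow_one, mk_eq_one_iff, word_one] at this
    have ht := h.sq
    rw [← h.trace_right] at ht
    obtain e | e := this <;> rw [e] at ht <;> norm_num at ht
    · exact one_ne_zero (by linear_combination ht)
    · exact h5 (by linear_combination ht)
  have : Fact (Nat.Prime 5) := ⟨Nat.prime_five⟩
  have := pow_eq_one_of_ncard_fixedBy (Y := OnePoint K) (G := φ.range) ?_ ?_ ?_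
    (orderOf_eq_prime hβ hβ1) (φ.rangeRestrict (FreeGroup.of 0 * FreeGroup.of 2))
  · obtain ⟨k2, k3, k5⟩ := h.trace_left_third_ne h2 h3 h29
    have e : word A B C (FreeGroup.of 0 * FreeGroup.of 2) = A * C := by simp
    rw [← e] at k2 k3 k5
    obtain this | this | this := this
    · exact k2 (hmk _ _ this)
    · exact k3 (hmk _ _ this)
    · exact k5 (hmk _ _ this)
  · rintro ⟨-, w, rfl⟩ hg
    refine ncard_fixed_moebius h2 fun htr => hg ?_
    have : ((word A B C w).1.trace - 2) * ((word A B C w).1.trace + 2) = 0 := by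
      linear_combination htr
    apply Subtype.ext
    obtain e | e := mul_eq_zero.1 this
    · change moebius (word A B C w) = 1
      rw [hw _ (pow_eq_one_of_trace_eq_two (sub_eq_zero.1 e)), map_one]
    · have hneg : word A B C (FreeGroup.of 0 ^ 3 * w) = -word A B C w := by
        rw [map_mul, map_pow, word_zero, h.left_pow_three, neg_one_mul]
      have := hw (FreeGroup.of 0 ^ 3 * w) (pow_eq_one_of_trace_eq_two (by
        rw [hneg, trace_neg_coe]; linear_combination -e))
      change moebius (word A B C w) = 1
      rw [hneg, neg_eq_iff_eq_neg] at this
      rw [this, moebius_neg_one]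
  · intro P hP
    have hmem : ∀ w, moebius (word A B C w) P = P := fun w => by
      have : φ.rangeRestrict w ∈ stabilizer φ.range P := hP ▸ Subgroup.mem_top _
      exact this
    exact h.not_fixed h2 h3 P ⟨by simpa using hmem (FreeGroup.of 0),
      by simpa using hmem (FreeGroup.of 1)⟩
  · intro S hS
    have : S.comap φ.rangeRestrict = ⊤ := by
      rw [eq_top_iff, ← FreeGroup.closure_range_of, Subgroup.closure_le]
      rintro _ ⟨i, rfl⟩
      change φ.rangeRestrict (FreeGroup.of i) ∈ S
      fin_cases i
      · have := hS (φ.rangeRestrict (FreeGroup.of 0) ^ 2)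
        rwa [← pow_mul, pow_succ, hα, one_mul] at this
      · have := hS (φ.rangeRestrict (FreeGroup.of 1) ^ 3)
        rwa [← pow_mul, pow_succ, hβ, one_mul] at this
      · have := hS (φ.rangeRestrict (FreeGroup.of 2) ^ 2)
        rwa [← pow_mul, pow_succ, hγ, one_mul] at this
    rw [eq_top_iff]
    rintro g -
    obtain ⟨w, rfl⟩ := φ.rangeRestrict_surjective g
    exact (this ▸ Subgroup.mem_top w : w ∈ S.comap φ.rangeRestrict)

lemma TetTriple.exists_unipotent {F : Type*} [Field F] [Finite F] [CharP F p] {t x : F}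
    {A B C : SL(2, F)} (h : TetTriple t x A.1 B.1 C.1) (h2 : (2 : F) ≠ 0) (h3 : (3 : F) ≠ 0)
    (h5 : (5 : F) ≠ 0) (h29 : (29 : F) ≠ 0) : ∃ w, word A B C w ^ p = 1 ∧ word A B C w ≠ 1 := by
  classical
  let σ := algebraMap F (AlgebraicClosure F)
  have : CharP (AlgebraicClosure F) p := charP_of_injective_algebraMap σ.injective p
  have hn : ∀ n : ℕ, [n.AtLeastTwo] → (OfNat.ofNat n : F) ≠ 0 →
      (OfNat.ofNat n : AlgebraicClosure F) ≠ 0 := fun n _ hn => by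
    rw [← map_ofNat σ]
    exact (map_ne_zero σ).2 hn
  have hinj : Function.Injective (Matrix.SpecialLinearGroup.map (n := Fin 2) σ) := by
    intro g g' hg
    ext i j
    have := congrArg (fun M : SL(2, AlgebraicClosure F) => M i j) hg
    exact σ.injective (by simpa using this)
  have hfin : Finite (word (A.map σ) (B.map σ) (C.map σ)).range := by
    have : word (A.map σ) (B.map σ) (C.map σ) =
        (Matrix.SpecialLinearGroup.map σ).comp (word A B C) := MonoidHom.ext (word_map σ A B C)
    rw [this, MonoidHom.range_comp]
    exact Finite.of_surjective _ (MonoidHom.subgroupMap_surjective _ (word A B C).range)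
  obtain ⟨w, hw, hw1⟩ := (h.map σ).exists_unipotent_of_isAlgClosed (p := p) (hn 2 h2) (hn 3 h3)
    (hn 5 h5) (hn 29 h29)
  rw [word_map] at hw hw1
  refine ⟨w, hinj (by rw [map_pow, hw, map_one]), fun e => hw1 (by rw [e, map_one])⟩

end ProjectiveLine

section Counting

lemma IsLift.surjective {F : Type*} [Field F] {f : Tet →* PSL(2, F)} {A B C : SL(2, F)}
    (hf : IsLift f A B C) (h : (word A B C).range = ⊤) : Function.Surjective f := by
  intro y
  obtain ⟨g, rfl⟩ := QuotientGroup.mk_surjective y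
  obtain ⟨w, rfl⟩ := MonoidHom.range_eq_top.1 h g
  exact ⟨_, hf w⟩

lemma ne_one_of_surjective {F : Type*} [Field F] {f : Tet →* PSL(2, F)}
    (hf : Function.Surjective f) : f ≠ 1 := by
  rintro rfl
  let Y : SL(2, F) := ⟨!![1, 1; 0, 1], by simp [det_fin_two]⟩
  obtain ⟨g, hg⟩ := hf (Y : PSL(2, F))
  rw [MonoidHom.one_apply, eq_comm, mk_eq_one_iff] at hg
  obtain hg | hg := hg <;>
    simpa [Y] using congrArg (fun M : SL(2, F) => M 0 1) hg

lemma exists_tetPair {F : Type*} [Field F] [Finite F] (h2 : (2 : F) ≠ 0) (h3 : (3 : F) ≠ 0) {t : F}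
    (ht : t ^ 2 = t + 1) : ∃ A B : SL(2, F), TetPair t A.1 B.1 := by
  classical
  have := Fintype.ofFinite F
  have hchar : ringChar F ≠ 2 := fun h => h2 (by
    have := ringChar.spec F 2
    rw [h] at this
    exact_mod_cast this.2 dvd_rfl)
  obtain ⟨u, q, huq⟩ := FiniteField.exists_root_sum_quadratic
    (f := (Polynomial.X ^ 2 : Polynomial F))
    (g := Polynomial.C 3 * Polynomial.X ^ 2 + Polynomial.C (2 * t) * Polynomial.X +
      Polynomial.C (4 - t ^ 2)) (by simp) (Polynomial.degree_quadratic h3)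
    (FiniteField.odd_card_of_char_ne_two hchar)
  simp only [Polynomial.eval_pow, Polynomial.eval_X, Polynomial.eval_add, Polynomial.eval_mul,
    Polynomial.eval_C] at huq
  obtain ⟨r, rfl⟩ : ∃ r, u = 2 * r + q - t := ⟨(u - q + t) / 2, by field_simp; ring⟩
  have hdet : (t - r) * r - q * (q + r) = 1 := by
    have h4 : (4 : F) ≠ 0 := by
      rw [show (4 : F) = 2 * 2 by norm_num]
      exact mul_ne_zero h2 h2
    apply mul_left_cancel₀ h4
    linear_combination -huq
  refine ⟨⟨!![0, -1; 1, 1], by simp [det_fin_two]⟩,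
    ⟨!![t - r, q; q + r, r], by simpa [det_fin_two] using hdet⟩, ?_⟩
  constructor <;> simp [det_fin_two, trace_fin_two, hdet, ht]

lemma TetPair.exists_isLift {F : Type*} [Field F] {t x : F} {A B : SL(2, F)}
    (h : TetPair t A.1 B.1) (h2 : (2 : F) ≠ 0) (hx : x ^ 2 - x + t - 1 = 0) :
    ∃ (C : SL(2, F)) (f : Tet →* PSL(2, F)), TetTriple t x A.1 B.1 C.1 ∧ IsLift f A B C := by
  have h' := h.triple h2 hx
  have h'' : TetTriple t x A.1 B.1 (⟨_, h'.det_third⟩ : SL(2, F)).1 := h'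
  obtain ⟨f, hf⟩ := h''.exists_isLift
  exact ⟨_, f, h'', hf⟩

section Roots

variable {k : Type*} [Field k]

lemma sq_sub_self_add_eq_zero_iff (h2 : (2 : k) ≠ 0) {c r x : k} (hr : r ^ 2 = 1 - 4 * c) :
    x ^ 2 - x + c = 0 ↔ x = (1 + r) / 2 ∨ x = (1 - r) / 2 := by
  have h4 : (4 : k) ≠ 0 := by
    rw [show (4 : k) = 2 * 2 by norm_num]
    exact mul_ne_zero h2 h2
  have e : x ^ 2 - x + c = (x - (1 + r) / 2) * (x - (1 - r) / 2) := by
    field_simp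
    linear_combination hr
  rw [e, mul_eq_zero, sub_eq_zero, sub_eq_zero]

lemma exists_algebraMap_eq_of_sq_sub_self_add_eq_zero {K : Type*} [Field K] [Algebra k K]
    (h2 : (2 : k) ≠ 0) {c r : k} (hr : r ^ 2 = 1 - 4 * c) {x : K}
    (hx : x ^ 2 - x + algebraMap k K c = 0) : ∃ y, algebraMap k K y = x := by
  have h2' : (2 : K) ≠ 0 := by
    rw [← map_ofNat (algebraMap k K)]
    exact (map_ne_zero _).2 h2
  have hr' : algebraMap k K r ^ 2 = 1 - 4 * algebraMap k K c := by
    rw [← map_pow, hr, map_sub, map_mul, map_one, map_ofNat]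
  obtain rfl | rfl := (sq_sub_self_add_eq_zero_iff h2' hr').1 hx
  · exact ⟨(1 + r) / 2, by rw [map_div₀, map_add, map_one, map_ofNat]⟩
  · exact ⟨(1 - r) / 2, by rw [map_div₀, map_sub, map_one, map_ofNat]⟩

lemma sq_eq_add_one_iff (h2 : (2 : k) ≠ 0) {s t : k} (hs : s ^ 2 = 5) :
    t ^ 2 = t + 1 ↔ t = (1 + s) / 2 ∨ t = (1 - s) / 2 := by
  rw [← sq_sub_self_add_eq_zero_iff h2 (c := -1) (by rw [hs]; norm_num), ← sub_eq_zero, ← sub_sub,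
    sub_eq_add_neg _ (1 : k)]

lemma exists_algebraMap_eq_of_sq {K : Type*} [Field K] [Algebra k K] (h2 : (2 : k) ≠ 0) {s : k}
    (hs : s ^ 2 = 5) {t : K} (ht : t ^ 2 = t + 1) : ∃ t₀ : k, algebraMap k K t₀ = t := by
  apply exists_algebraMap_eq_of_sq_sub_self_add_eq_zero h2 (c := -1) (r := s)
  · rw [hs]
    norm_num
  · rw [map_neg, map_one, ht]
    ring

end Roots

variable {p : ℕ} [Fact p.Prime]

lemma TetTriple.surjective (h2 : (2 : ZMod p) ≠ 0) (h3 : (3 : ZMod p) ≠ 0) (h5 : (5 : ZMod p) ≠ 0)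
    (h29 : (29 : ZMod p) ≠ 0) {t x : ZMod p} {A B C : SL(2, ZMod p)}
    {f : Tet →* PSL(2, ZMod p)} (h : TetTriple t x A.1 B.1 C.1) (hf : IsLift f A B C) :
    Function.Surjective f := by
  obtain ⟨w, hw, hw1⟩ := h.exists_unipotent (p := p) h2 h3 h5 h29
  exact hf.surjective (h.toTetPair.eq_top_of_unipotent h2 h3 ⟨FreeGroup.of 0, by simp⟩
    ⟨FreeGroup.of 1, by simp⟩ ⟨w, rfl⟩ hw hw1)

/-- The kernels of epimorphisms to `PSL(2, p)` correspond to the solutions of the equations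
for the traces. -/
lemma exists_bijOn_zmod (h2 : (2 : ZMod p) ≠ 0) (h3 : (3 : ZMod p) ≠ 0) (h5 : (5 : ZMod p) ≠ 0)
    (h29 : (29 : ZMod p) ≠ 0) :
    ∃ κ : ZMod p × ZMod p → Subgroup Tet, Set.BijOn κ
      {a | a.1 ^ 2 = a.1 + 1 ∧ a.2 ^ 2 - a.2 + a.1 - 1 = 0} {K | IsPSLQuotient (ZMod p) K} := by
  have hp : p ≠ 2 := by
    rintro rfl
    exact h2 rfl
  have hex : ∀ a : ZMod p × ZMod p, a.1 ^ 2 = a.1 + 1 ∧ a.2 ^ 2 - a.2 + a.1 - 1 = 0 →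
      ∃ (f : Tet →* PSL(2, ZMod p)) (A B C : SL(2, ZMod p)),
        TetTriple a.1 a.2 A.1 B.1 C.1 ∧ IsLift f A B C := by
    rintro ⟨t, x⟩ ⟨ht, hx⟩
    obtain ⟨A, B, h⟩ := exists_tetPair h2 h3 ht
    obtain ⟨C, f, h', hf⟩ := h.exists_isLift h2 hx
    exact ⟨f, A, B, C, h', hf⟩
  choose! f A B C h hf using hex
  refine ⟨fun a => (f a).ker, fun a ha => ⟨f a, (h a ha).surjective h2 h3 h5 h29 (hf a ha), rfl⟩,
    fun a ha b hb hab => ?_, ?_⟩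
  · have hs := (h a ha).surjective h2 h3 h5 h29 (hf a ha)
    have hs' := (h b hb).surjective h2 h3 h5 h29 (hf b hb)
    have hid : ∀ g : SL(2, ZMod p), g.map (algebraMap (ZMod p) (ZMod p)) = g := fun g => by
      ext i j; simp
    have ha' := h a ha
    have hfa := hf a ha
    rw [← hid (A a), ← hid (B a)] at ha' hfa
    exact Prod.ext (ha'.right_eq_of_ker_eq hp h2 hfa (h b hb) (hf b hb) hs hs' hab)
      ((h a ha).left_third_eq_of_ker_eq hp h2 (hf a ha) (h b hb) (hf b hb) hs hs' hab)
  · rintro K ⟨g, hg, rfl⟩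
    obtain ⟨t, x, A', B', C', h', hg'⟩ := exists_tetTriple (ne_one_of_surjective hg)
    have ha : (t, x).1 ^ 2 = (t, x).1 + 1 ∧ (t, x).2 ^ 2 - (t, x).2 + (t, x).1 - 1 = 0 :=
      ⟨h'.sq, h'.eq_zero h2⟩
    exact ⟨(t, x), ha, (h _ ha).ker_eq (RingHom.id _) (hf _ ha) h' hg'⟩

section Quadratic

variable {F : Type} [Field F] [Algebra (ZMod p) F]

lemma exists_root_of_finrank_eq_two [Finite F] (h2 : (2 : ZMod p) ≠ 0)
    (hF : Module.finrank (ZMod p) F = 2) (t : ZMod p) :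
    ∃ x : F, x ^ 2 - x + algebraMap _ F t - 1 = 0 := by
  have := Fintype.ofFinite F
  have : CharP F p := charP_of_injective_algebraMap (algebraMap (ZMod p) F).injective p
  have h2' : (2 : F) ≠ 0 := by
    rw [← map_ofNat (algebraMap (ZMod p) F)]
    exact (map_ne_zero _).2 h2
  have hp : p ≠ 2 := by
    rintro rfl
    exact h2 rfl
  have hsq : IsSquare (algebraMap (ZMod p) F (5 - 4 * t)) := by
    by_cases h0 : 5 - 4 * t = 0
    · simp [h0]
    · have hcard : Fintype.card F = p ^ 2 := by
        rw [← Nat.card_eq_fintype_card, ← FiniteField.pow_finrank_eq_natCard p F, hF]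
      obtain ⟨m, hm⟩ := (Fact.out : p.Prime).odd_of_ne_two hp
      rw [FiniteField.isSquare_iff (by rwa [ringChar.eq F p]) ((map_ne_zero _).2 h0), hcard,
        show p ^ 2 / 2 = (p - 1) * (m + 1) by
          rw [hm, Nat.add_sub_cancel, show (2 * m + 1) ^ 2 = 2 * (2 * m * (m + 1)) + 1 by ring,
            Nat.mul_add_div two_pos]
          rfl, pow_mul, ← map_pow, ZMod.pow_card_sub_one_eq_one h0]
      simp
  obtain ⟨r, hr⟩ := hsq
  simp only [map_sub, map_mul, map_ofNat] at hr
  rw [← sq] at hr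
  refine ⟨(1 + r) / 2, ?_⟩
  rw [add_sub_assoc]
  exact (sq_sub_self_add_eq_zero_iff h2' (by linear_combination -hr)).2 (Or.inl rfl)

lemma TetTriple.surjective_of_finrank_eq_two [Finite F] (h2 : (2 : ZMod p) ≠ 0)
    (h3 : (3 : ZMod p) ≠ 0) (hF : Module.finrank (ZMod p) F = 2)
    (h5 : (5 : ZMod p) ≠ 0) (h29 : (29 : ZMod p) ≠ 0) {t x : F}
    {A B C : SL(2, F)} {f : Tet →* PSL(2, F)} (h : TetTriple t x A.1 B.1 C.1)
    (hx : ∀ k : ZMod p, algebraMap _ F k ≠ x) (hf : IsLift f A B C) : Function.Surjective f := by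
  have : CharP F p := charP_of_injective_algebraMap (algebraMap (ZMod p) F).injective p
  have hn : ∀ n : ℕ, [n.AtLeastTwo] → (OfNat.ofNat n : ZMod p) ≠ 0 →
      (OfNat.ofNat n : F) ≠ 0 := fun n _ hn => by
    rw [← map_ofNat (algebraMap (ZMod p) F)]
    exact (map_ne_zero _).2 hn
  obtain ⟨w, hw, hw1⟩ := h.exists_unipotent (p := p) (hn 2 h2) (hn 3 h3) (hn 5 h5) (hn 29 h29)
  exact hf.surjective (h.eq_top_of_unipotent hF hx h2 h3 ⟨FreeGroup.of 0, by simp⟩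
    ⟨FreeGroup.of 1, by simp⟩ ⟨FreeGroup.of 2, by simp⟩ ⟨w, rfl⟩ hw hw1)

/-- The Frobenius automorphism exchanges the roots of `X² - X + t - 1`. -/
lemma frobenius_root [CharP F p] {t : ZMod p} {x y : F}
    (hx : x ^ 2 - x + algebraMap _ F t - 1 = 0) (hx' : ∀ k : ZMod p, algebraMap _ F k ≠ x)
    (hy : y ^ 2 - y + algebraMap _ F t - 1 = 0) : y = x ∨ y = frobenius F p x := by
  have hfx : frobenius F p x ≠ x := by
    intro e
    obtain ⟨k, hk⟩ := (bot_le : ⊥ ≤ (algebraMap (ZMod p) F).fieldRange)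
      ((Subfield.mem_bot_iff_pow_eq_self (F := F) (p := p)).2 (by rwa [frobenius_def] at e))
    exact hx' k hk
  have hf := congrArg (frobenius F p) hx
  rw [map_sub, map_add, map_sub, map_pow, map_one, map_zero, frobenius_def p (algebraMap _ F t),
    ← map_pow (algebraMap (ZMod p) F), ZMod.pow_card] at hf
  generalize frobenius F p x = z at *
  have e : (z - x) * (z + x - 1) = 0 := by linear_combination hf - hx
  have e := (mul_eq_zero.1 e).resolve_left (sub_ne_zero.2 hfx)
  have : (y - x) * (y - z) = 0 := by grind
  obtain h | h := mul_eq_zero.1 this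
  · exact Or.inl (sub_eq_zero.1 h)
  · exact Or.inr (sub_eq_zero.1 h)

/-- If the traces do not all lie in the prime field, then the kernels of epimorphisms to
`PSL(2, p²)` correspond to the solutions of the equation for the trace of `β`. -/
lemma exists_bijOn_of_finrank_eq_two [Finite F] (h2 : (2 : ZMod p) ≠ 0)
    (h3 : (3 : ZMod p) ≠ 0) (hF : Module.finrank (ZMod p) F = 2)
    (h5 : (5 : ZMod p) ≠ 0) (h29 : (29 : ZMod p) ≠ 0) {s : ZMod p} (hs : s ^ 2 = 5)
    (hx : ∀ t x : ZMod p, t ^ 2 = t + 1 → x ^ 2 - x + t - 1 ≠ 0) :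
    ∃ κ : ZMod p → Subgroup Tet, Set.BijOn κ {t | t ^ 2 = t + 1} {K | IsPSLQuotient F K} := by
  have : CharP F p := charP_of_injective_algebraMap (algebraMap (ZMod p) F).injective p
  have hp : p ≠ 2 := by
    rintro rfl
    exact h2 rfl
  have h2' : (2 : F) ≠ 0 := by
    rw [← map_ofNat (algebraMap (ZMod p) F)]
    exact (map_ne_zero _).2 h2
  have hx' : ∀ (t : ZMod p) (x : F), t ^ 2 = t + 1 → x ^ 2 - x + algebraMap _ F t - 1 = 0 →
      ∀ k : ZMod p, algebraMap _ F k ≠ x := by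
    rintro t - ht hxt k rfl
    refine hx t k ht ((algebraMap (ZMod p) F).injective ?_)
    simpa using hxt
  have hex : ∀ t : ZMod p, t ^ 2 = t + 1 → ∃ (f : Tet →* PSL(2, F)) (x : F)
      (A B : SL(2, ZMod p)) (C : SL(2, F)),
        TetTriple (algebraMap _ F t) x (A.map (algebraMap (ZMod p) F)).1
          (B.map (algebraMap (ZMod p) F)).1 C.1 ∧
        IsLift f (A.map (algebraMap (ZMod p) F)) (B.map (algebraMap (ZMod p) F)) C := by
    intro t ht
    obtain ⟨A, B, h⟩ := exists_tetPair h2 h3 ht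
    obtain ⟨x, hx⟩ := exists_root_of_finrank_eq_two (F := F) h2 hF t
    obtain ⟨C, f, h', hf⟩ := (h.map (algebraMap (ZMod p) F)).exists_isLift h2' hx
    exact ⟨f, x, A, B, C, h', hf⟩
  choose! f x A B C h hf using hex
  have hsurj : ∀ t, t ^ 2 = t + 1 → Function.Surjective (f t) := fun t ht =>
    (h t ht).surjective_of_finrank_eq_two h2 h3 hF h5 h29
      (hx' t (x t) ht ((h t ht).eq_zero h2')) (hf t ht)
  refine ⟨fun t => (f t).ker, fun t ht => ⟨f t, hsurj t ht, rfl⟩, fun a ha b hb hab => ?_, ?_⟩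
  · exact (algebraMap (ZMod p) F).injective ((h a ha).right_eq_of_ker_eq hp h2' (hf a ha) (h b hb)
      (hf b hb) (hsurj a ha) (hsurj b hb) hab)
  · rintro K ⟨g, hg, rfl⟩
    obtain ⟨t', y, A', B', C', h', hg'⟩ := exists_tetTriple (ne_one_of_surjective hg)
    obtain ⟨t, rfl⟩ := exists_algebraMap_eq_of_sq h2 hs h'.sq
    have ht : t ^ 2 = t + 1 := (algebraMap (ZMod p) F).injective (by simpa using h'.sq)
    refine ⟨t, ht, ?_⟩
    have hxt := (h t ht).eq_zero h2'
    obtain rfl | rfl := frobenius_root hxt (hx' t _ ht hxt) (h'.eq_zero h2')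
    · exact (h t ht).ker_eq (RingHom.id F) (hf t ht) h' hg'
    · refine (h t ht).ker_eq (frobenius F p) (hf t ht) ?_ hg'
      rwa [frobenius_def p (algebraMap _ F t), ← map_pow, ZMod.pow_card]

end Quadratic

end Counting

section Main

variable {p : ℕ} [Fact p.Prime]

lemma prime_cast_ne_zero {q : ℕ} (hq : q.Prime) (hpq : p ≠ q) : (q : ZMod p) ≠ 0 := by
  rw [Ne, ZMod.natCast_eq_zero_iff, Nat.prime_dvd_prime_iff_eq Fact.out hq]
  exact hpq

lemma ncard_solutions {k : Type*} [Field k] (h2 : (2 : k) ≠ 0) (h5 : (5 : k) ≠ 0)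
    (h11 : (11 : k) ≠ 0) {s a b : k} (hs : s ^ 2 = 5) (ha : a ^ 2 = 3 + 2 * s)
    (hb : b ^ 2 = 3 - 2 * s) :
    {y : k × k | y.1 ^ 2 = y.1 + 1 ∧ y.2 ^ 2 - y.2 + y.1 - 1 = 0}.ncard = 4 := by
  classical
  have hne : ∀ {z : k}, z ≠ 0 → (1 + z) / 2 ≠ (1 - z) / 2 := fun {z} hz h => by
    field_simp at h
    have : 2 * z = 0 := by linear_combination h
    simp [h2, hz] at this
  have hs0 : s ≠ 0 := by
    rintro rfl
    exact h5 (by linear_combination -hs)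
  have hab : a ^ 2 * b ^ 2 ≠ 0 := by
    intro h
    exact h11 (by rw [ha, hb] at h; linear_combination -h - 4 * hs)
  have ha0 : a ≠ 0 := by
    rintro rfl
    simp at hab
  have hb0 : b ≠ 0 := by
    rintro rfl
    simp at hab
  have e : {y : k × k | y.1 ^ 2 = y.1 + 1 ∧ y.2 ^ 2 - y.2 + y.1 - 1 = 0} =
      (({(1 + s) / 2} : Finset k) ×ˢ {(1 + b) / 2, (1 - b) / 2} ∪
        ({(1 - s) / 2} : Finset k) ×ˢ {(1 + a) / 2, (1 - a) / 2} : Finset (k × k)) := by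
    ext ⟨t, x⟩
    simp only [Set.mem_ofPred, sq_eq_add_one_iff h2 hs, add_sub_assoc, Finset.coe_union,
      Finset.coe_product, Finset.coe_singleton, Finset.coe_insert, Set.mem_union, Set.mem_prod,
      Set.mem_singleton_iff, Set.mem_insert_iff, or_and_right]
    refine or_congr (and_congr_right ?_) (and_congr_right ?_)
    · rintro rfl
      exact sq_sub_self_add_eq_zero_iff h2 (by rw [hb]; field_simp; ring)
    · rintro rfl
      exact sq_sub_self_add_eq_zero_iff h2 (by rw [ha]; field_simp; ring)
  rw [e, Set.ncard_coe_finset, Finset.card_union_of_disjoint, Finset.card_product,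
    Finset.card_product, Finset.card_pair (hne ha0), Finset.card_pair (hne hb0)]
  · simp
  · rw [Finset.disjoint_product]
    exact Or.inl (by simpa using hne hs0)

lemma ncard_traces {k : Type*} [Field k] (h2 : (2 : k) ≠ 0) (h5 : (5 : k) ≠ 0) {s : k}
    (hs : s ^ 2 = 5) : {t : k | t ^ 2 = t + 1}.ncard = 2 := by
  have e : {t : k | t ^ 2 = t + 1} = {(1 + s) / 2, (1 - s) / 2} := by
    ext t
    simp [sq_eq_add_one_iff h2 hs]
  rw [e, Set.ncard_pair]
  intro h
  field_simp at h
  have : 2 * s = 0 := by linear_combination h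
  have hs0 : s = 0 := by simpa [h2] using this
  rw [hs0] at hs
  exact h5 (by linear_combination -hs)

end Main

end TetPSL

open TetPSL

theorem stmt_3 (p : ℕ) [Fact p.Prime]
    (h5 : p % 5 = 1 ∨ p % 5 = 4)
    (h11 : p % 11 = 1 ∨ p % 11 = 3 ∨ p % 11 = 4 ∨ p % 11 = 5 ∨ p % 11 = 9)
    (s : ZMod p) (hs : s ^ 2 = 5) :
    (IsSquare (3 + 2 * s) ∧ IsSquare (3 - 2 * s) →
      {K : Subgroup Tet | IsPSLQuotient (ZMod p) K}.ncard = 4 ∧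
      ∀ K : Subgroup Tet, ¬ IsPSLQuotient (GaloisField p 2) K) ∧
    (¬ IsSquare (3 + 2 * s) ∧ ¬ IsSquare (3 - 2 * s) →
      {K : Subgroup Tet | IsPSLQuotient (GaloisField p 2) K}.ncard = 2 ∧
      ∀ K : Subgroup Tet, ¬ IsPSLQuotient (ZMod p) K) := by
  have c2 : (2 : ZMod p) ≠ 0 := prime_cast_ne_zero (q := 2) Nat.prime_two (by omega)
  have c3 : (3 : ZMod p) ≠ 0 := prime_cast_ne_zero (q := 3) Nat.prime_three (by omega)
  have c5 : (5 : ZMod p) ≠ 0 := prime_cast_ne_zero (q := 5) Nat.prime_five (by omega)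
  have c11 : (11 : ZMod p) ≠ 0 := prime_cast_ne_zero (q := 11) Nat.prime_eleven (by omega)
  have c29 : (29 : ZMod p) ≠ 0 :=
    prime_cast_ne_zero (q := 29) (by norm_num) (by omega)
  have hF : Module.finrank (ZMod p) (GaloisField p 2) = 2 := GaloisField.finrank p two_ne_zero
  have c2' : (2 : GaloisField p 2) ≠ 0 := by
    rw [← map_ofNat (algebraMap (ZMod p) (GaloisField p 2))]
    exact (map_ne_zero _).2 c2
  have htr : ∀ t : ZMod p, t ^ 2 = t + 1 → 1 - 4 * (t - 1) = 3 - 2 * s ∨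
      1 - 4 * (t - 1) = 3 + 2 * s := by
    intro t ht
    obtain rfl | rfl := (sq_eq_add_one_iff c2 hs).1 ht
    · exact Or.inl (by field_simp; ring)
    · exact Or.inr (by field_simp; ring)
  refine ⟨fun ⟨⟨a, ha⟩, ⟨b, hb⟩⟩ => ⟨?_, ?_⟩, fun ⟨ha, hb⟩ => ?_⟩
  · obtain ⟨κ, hκ⟩ := exists_bijOn_zmod c2 c3 c5 c29
    rw [← hκ.image_eq, hκ.injOn.ncard_image]
    exact ncard_solutions c2 c5 c11 hs (by rw [ha, sq]) (by rw [hb, sq])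
  · rintro K ⟨f, hf, -⟩
    obtain ⟨t', x', A, B, C, h, hl⟩ := exists_tetTriple (ne_one_of_surjective hf)
    obtain ⟨t, rfl⟩ := exists_algebraMap_eq_of_sq c2 hs h.sq
    have ht : t ^ 2 = t + 1 := (algebraMap (ZMod p) (GaloisField p 2)).injective (by
      simpa using h.sq)
    obtain ⟨r, hr⟩ : ∃ r, r ^ 2 = 1 - 4 * (t - 1) := by
      obtain e | e := htr t ht <;> rw [e]
      · exact ⟨b, by rw [hb, sq]⟩
      · exact ⟨a, by rw [ha, sq]⟩
    have hx := h.eq_zero c2'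
    rw [add_sub_assoc, ← map_one (algebraMap (ZMod p) (GaloisField p 2)), ← map_sub] at hx
    obtain ⟨x, rfl⟩ := exists_algebraMap_eq_of_sq_sub_self_add_eq_zero c2 hr hx
    refine h.not_surjective hl (fun hs => ?_) hf
    have := LinearMap.finrank_le_finrank_of_surjective
      (f := Algebra.linearMap (ZMod p) (GaloisField p 2)) hs
    rw [hF, Module.finrank_self] at this
    omega
  · have key : ∀ t x : ZMod p, t ^ 2 = t + 1 → x ^ 2 - x + t - 1 ≠ 0 := by
      intro t x ht hx
      have hsq : 1 - 4 * (t - 1) = (2 * x - 1) * (2 * x - 1) := by linear_combination -4 * hx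
      obtain e | e := htr t ht <;> rw [e] at hsq
      · exact hb ⟨_, hsq⟩
      · exact ha ⟨_, hsq⟩
    refine ⟨?_, ?_⟩
    · obtain ⟨κ, hκ⟩ := exists_bijOn_of_finrank_eq_two (F := GaloisField p 2) c2 c3 hF c5 c29 hs key
      rw [← hκ.image_eq, hκ.injOn.ncard_image]
      exact ncard_traces c2 c5 hs
    · rintro K ⟨f, hf, -⟩
      obtain ⟨t, x, A, B, C, h, -⟩ := exists_tetTriple (ne_one_of_surjective hf)
      exact key t x h.sq (h.eq_zero c2)
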